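/- arXiv:1611.03280 — 3 statements merged into one kernel-verified Lean document; each statement's English description precedes it below -/
import Mathlib

section
/- Let R be a commutative noetherian ring and M an R-module of finite injective dimension. Then inj dim_R M = sup over all prime ideals p of R of ( depth R_p − width_{R_p} M_p ). -/
open CategoryTheory Opposite

noncomputable section

/-- The `n`-th Ext group of `R`-modules `X` and `M`, i.e. `Ext^n_R(X, M)`. -/
def extModule (R : Type) [CommRing R] (n : ℕ) (X M : ModuleCat R) : ModuleCat R :=
  ((Ext R (ModuleCat R) n).obj (op X)).obj M

/-- The `n`-th Tor group of `R`-modules `X` and `M`, i.e. `Tor_n^R(X, M)`. -/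
def torModule (R : Type) [CommRing R] (n : ℕ) (X M : ModuleCat R) : ModuleCat R :=
  ((Tor (ModuleCat R) n).obj X).obj M

/-- The residue field `k(p) = R_p / p R_p` at a prime ideal `p`. -/
abbrev resField (R : Type) [CommRing R] (p : Ideal R) [p.IsPrime] : Type :=
  IsLocalRing.ResidueField (Localization.AtPrime p)

/-- `depth_R M := inf{ i : Ext^i_R(k, M) ≠ 0 }`, as an extended real (`⊤ = ∞` if all vanish). -/
noncomputable def edepth (R : Type) [CommRing R] (k M : ModuleCat R) : EReal :=
  sInf {x : EReal | ∃ i : ℕ, x = (i : EReal) ∧ Nontrivial (extModule R i k M)}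

/-- `width_R M := inf{ i : Tor_i^R(k, M) ≠ 0 }`, as an extended real (`⊤ = ∞` if all vanish). -/
noncomputable def ewidth (R : Type) [CommRing R] (k M : ModuleCat R) : EReal :=
  sInf {x : EReal | ∃ i : ℕ, x = (i : EReal) ∧ Nontrivial (torModule R i k M)}

/-- `sup{ i : Ext^i_R(k, M) ≠ 0 }`, as an extended real (`⊥ = -∞` if all vanish). -/
noncomputable def extSup (R : Type) [CommRing R] (k M : ModuleCat R) : EReal :=
  sSup {x : EReal | ∃ i : ℕ, x = (i : EReal) ∧ Nontrivial (extModule R i k M)}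

/-- `sup{ i : Tor_i^R(k, M) ≠ 0 }`, as an extended real (`⊥ = -∞` if all vanish). -/
noncomputable def torSup (R : Type) [CommRing R] (k M : ModuleCat R) : EReal :=
  sSup {x : EReal | ∃ i : ℕ, x = (i : EReal) ∧ Nontrivial (torModule R i k M)}

/-- The injective dimension of `M`, as an extended real:
`sup{ i : Ext^i_R(N, M) ≠ 0 for some N }` (so `⊥ = -∞` for the zero module). -/
noncomputable def einjDim (R : Type) [CommRing R] (M : ModuleCat R) : EReal :=
  sSup {x : EReal | ∃ (i : ℕ) (N : ModuleCat R), x = (i : EReal) ∧ Nontrivial (extModule R i N M)}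

/-- The complex `Hom(P, Y)` is exact in degree `n`. -/
def HomExactAt {R : Type} [CommRing R] (P : ChainComplex (ModuleCat.{0} R) ℕ) (Y : ModuleCat.{0} R)
    (n : ℕ) : Prop :=
  ∀ f : P.X n ⟶ Y, P.d (n + 1) n ≫ f = 0 → ∃ g : P.X (n - 1) ⟶ Y, P.d n (n - 1) ≫ g = f

lemma ChainComplex.d_zero_zero_sub {C : Type*} [Category* C] [Limits.HasZeroMorphisms C]
    (P : ChainComplex C ℕ) : P.d 0 (0 - 1) = 0 :=
  P.shape _ _ (by simp)

section Bridge

variable {R : Type} [CommRing R]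

lemma homExactAt_iff_isZero_homology (P : ChainComplex (ModuleCat.{0} R) ℕ) (Y : ModuleCat.{0} R)
    (n : ℕ) : HomExactAt P Y n ↔
      Limits.IsZero ((P.linearYonedaObj R Y).homology n) := by
  have hn : (ComplexShape.up ℕ).next n = n + 1 := by simp
  have key : ∀ i, (ComplexShape.up ℕ).prev n = i → P.d n (n - 1) = 0 ∧ P.d n i = 0 ∨ n - 1 = i →
      (HomExactAt P Y n ↔ Limits.IsZero ((P.linearYonedaObj R Y).homology n)) := by
    intro i hi h
    rw [← HomologicalComplex.exactAt_iff_isZero_homology,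
      HomologicalComplex.exactAt_iff' _ _ _ _ hi hn, ShortComplex.moduleCat_exact_iff]
    refine forall_congr' fun f => forall_congr' fun hf => ?_
    rcases h with ⟨h1, h2⟩ | rfl
    · constructor
      · rintro ⟨g, rfl⟩
        refine ⟨0, ?_⟩
        rw [map_zero, h1, Limits.zero_comp]
        rfl
      · rintro ⟨g, hg⟩
        refine ⟨0, ?_⟩
        have hg' : P.d n i ≫ (show P.X i ⟶ Y from g) = f := hg
        rw [← hg', h2, Limits.comp_zero, Limits.zero_comp]
    · rfl
  cases n with
  | zero => exact key 0 (by simp) (Or.inl ⟨P.d_zero_zero_sub, P.shape _ _ (by simp)⟩)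
  | succ p => exact key p (by simp) (Or.inr rfl)

lemma subsingleton_ext_zero_iff {X Y : ModuleCat.{0} R} :
    Subsingleton (Abelian.Ext.{0} X Y 0) ↔ ∀ f : X ⟶ Y, f = 0 := by
  rw [Abelian.Ext.homEquiv₀.subsingleton_congr]
  exact ⟨fun h f => Subsingleton.elim _ _, fun h => ⟨fun f g => (h f).trans (h g).symm⟩⟩

lemma CategoryTheory.ProjectiveResolution.exists_augmentation {X : ModuleCat.{0} R}
    (P : ProjectiveResolution X) : ∃ π : P.complex.X 0 ⟶ X, Epi π ∧ P.complex.d 1 0 ≫ π = 0 ∧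
      ∀ (Y : ModuleCat.{0} R) (f : P.complex.X 0 ⟶ Y), P.complex.d 1 0 ≫ f = 0 →
        ∃ g : X ⟶ Y, π ≫ g = f :=
  ⟨P.π.f 0, inferInstanceAs (Epi (P.π.f 0)), P.complex_d_comp_π_f_zero,
    fun _ f hf => ⟨P.exact₀.desc f hf, P.exact₀.g_desc f hf⟩⟩

lemma CategoryTheory.ProjectiveResolution.subsingleton_ext_iff {X : ModuleCat.{0} R}
    (P : ProjectiveResolution X) (Y : ModuleCat.{0} R) (n : ℕ) :
    Subsingleton (Abelian.Ext.{0} X Y n) ↔ HomExactAt P.complex Y n := by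
  cases n with
  | zero =>
    rw [subsingleton_ext_zero_iff]
    obtain ⟨π, _, hπ, hdesc⟩ := P.exists_augmentation
    constructor
    · intro h f hf
      refine ⟨0, ?_⟩
      obtain ⟨g, hg⟩ := hdesc Y f hf
      rw [← hg, h g, Limits.comp_zero, Limits.comp_zero]
    · intro h f
      obtain ⟨g, hg⟩ := h (π ≫ f) (by rw [reassoc_of% hπ, Limits.zero_comp])
      rw [ChainComplex.d_zero_zero_sub, Limits.zero_comp] at hg
      rw [← cancel_epi π, ← hg, Limits.comp_zero]
  | succ p =>
    constructor
    · intro h f hf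
      exact (P.extMk_eq_zero_iff f (p + 1 + 1) rfl hf p rfl).1 (Subsingleton.elim _ _)
    · intro h
      refine ⟨fun a b => ?_⟩
      have : ∀ a : Abelian.Ext.{0} X Y (p + 1), a = 0 := by
        intro a
        obtain ⟨f, hf, rfl⟩ := P.extMk_surjective a (p + 1 + 1) rfl
        exact (P.extMk_eq_zero_iff f (p + 1 + 1) rfl hf p rfl).2 (h f hf)
      rw [this a, this b]

lemma subsingleton_extModule_iff (n : ℕ) (X Y : ModuleCat.{0} R) :
    Subsingleton (extModule R n X Y) ↔ Subsingleton (Abelian.Ext.{0} X Y n) := by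
  have P := projectiveResolution X
  rw [P.subsingleton_ext_iff, homExactAt_iff_isZero_homology, ← (P.isoExt n Y).isZero_iff,
    ModuleCat.isZero_iff_subsingleton]
  rfl

lemma nontrivial_extModule_iff (n : ℕ) (X Y : ModuleCat.{0} R) :
    Nontrivial (extModule R n X Y) ↔ Nontrivial (Abelian.Ext.{0} X Y n) := by
  rw [← not_subsingleton_iff_nontrivial, ← not_subsingleton_iff_nontrivial,
    subsingleton_extModule_iff]

end Bridge

section Shift

open Abelian

variable {C : Type*} [Category* C] [Abelian C] [HasExt.{0} C] {S : ShortComplex C}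

namespace CategoryTheory.ShortComplex.ShortExact

lemma precomp_surjective (hS : S.ShortExact) (Y : C) (n : ℕ)
    (h₃ : Subsingleton (Ext.{0} S.X₃ Y (n + 1))) (x : Ext.{0} S.X₁ Y n) :
    ∃ y : Ext.{0} S.X₂ Y n, (Ext.mk₀ S.f).comp y (zero_add n) = x :=
  Ext.contravariant_sequence_exact₁ hS Y x (add_comm 1 n) (Subsingleton.elim _ _)

lemma subsingleton_ext_contra_iff (hS : S.ShortExact) [Projective S.X₂] (Y : C) (n : ℕ) :
    Subsingleton (Ext.{0} S.X₃ Y (n + 2)) ↔ Subsingleton (Ext.{0} S.X₁ Y (n + 1)) := by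
  constructor
  · intro h
    refine subsingleton_of_forall_eq 0 fun x => ?_
    obtain ⟨y, rfl⟩ := hS.precomp_surjective Y (n + 1) h x
    rw [Ext.eq_zero_of_projective y, Ext.comp_zero]
  · intro h
    refine subsingleton_of_forall_eq 0 fun x => ?_
    obtain ⟨y, rfl⟩ := Ext.contravariant_sequence_exact₃ hS Y x
      (Ext.eq_zero_of_projective _) (n₀ := n + 1) (by lia)
    rw [Subsingleton.elim y 0, Ext.comp_zero]

lemma subsingleton_ext_one_contra_iff (hS : S.ShortExact) [Projective S.X₂] (Y : C) :
    Subsingleton (Ext.{0} S.X₃ Y 1) ↔ ∀ f : S.X₁ ⟶ Y, ∃ g : S.X₂ ⟶ Y, S.f ≫ g = f := by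
  constructor
  · intro h f
    obtain ⟨y, hy⟩ := hS.precomp_surjective Y 0 h (Ext.mk₀ f)
    refine ⟨Ext.homEquiv₀ y, (Ext.mk₀_bijective _ _).1 ?_⟩
    rw [← Ext.mk₀_comp_mk₀, Ext.mk₀_homEquiv₀_apply, hy]
  · intro h
    refine subsingleton_of_forall_eq 0 fun x => ?_
    obtain ⟨y, rfl⟩ := Ext.contravariant_sequence_exact₃ hS Y x
      (Ext.eq_zero_of_projective _) (n₀ := 0) (by lia)
    obtain ⟨g, hg⟩ := h (Ext.homEquiv₀ y)
    rw [← Ext.mk₀_homEquiv₀_apply y, ← hg, ← Ext.mk₀_comp_mk₀, hS.extClass_comp_assoc]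

lemma subsingleton_ext_cov_iff (hS : S.ShortExact) [Injective S.X₂] (X : C) (n : ℕ) :
    Subsingleton (Ext.{0} X S.X₁ (n + 2)) ↔ Subsingleton (Ext.{0} X S.X₃ (n + 1)) := by
  constructor
  · intro h
    refine subsingleton_of_forall_eq 0 fun x => ?_
    obtain ⟨y, rfl⟩ := Ext.covariant_sequence_exact₃ X hS x (n₁ := n + 2) rfl
      (Subsingleton.elim _ _)
    rw [Ext.eq_zero_of_injective y, Ext.zero_comp]
  · intro h
    refine subsingleton_of_forall_eq 0 fun x => ?_
    obtain ⟨y, rfl⟩ := Ext.covariant_sequence_exact₁ X hS x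
      (Ext.eq_zero_of_injective _) (n₀ := n + 1) (by lia)
    rw [Subsingleton.elim y 0, Ext.zero_comp]

lemma subsingleton_ext_one_cov_iff (hS : S.ShortExact) [Injective S.X₂] (X : C) :
    Subsingleton (Ext.{0} X S.X₁ 1) ↔ ∀ f : X ⟶ S.X₃, ∃ g : X ⟶ S.X₂, g ≫ S.g = f := by
  constructor
  · intro h f
    obtain ⟨y, hy⟩ := Ext.covariant_sequence_exact₃ X hS (Ext.mk₀ f) (n₁ := 1) rfl
      (Subsingleton.elim _ _)
    refine ⟨Ext.homEquiv₀ y, (Ext.mk₀_bijective _ _).1 ?_⟩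
    rw [← Ext.mk₀_comp_mk₀, Ext.mk₀_homEquiv₀_apply, hy]
  · intro h
    refine subsingleton_of_forall_eq 0 fun x => ?_
    obtain ⟨y, rfl⟩ := Ext.covariant_sequence_exact₁ X hS x
      (Ext.eq_zero_of_injective _) (n₀ := 0) (by lia)
    obtain ⟨g, hg⟩ := h (Ext.homEquiv₀ y)
    rw [← Ext.mk₀_homEquiv₀_apply y, ← hg, ← Ext.mk₀_comp_mk₀,
      Ext.comp_assoc_of_second_deg_zero, hS.comp_extClass, Ext.comp_zero]

end CategoryTheory.ShortComplex.ShortExact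

end Shift

section FiniteResolution

variable {R : Type} [CommRing R]

lemma exists_projective_cover (X : ModuleCat.{0} R) : ∃ (P : ModuleCat.{0} R) (π : P ⟶ X),
    Projective P ∧ Epi π ∧ (Module.Finite R X → Module.Finite R P) := by
  by_cases h : Module.Finite R X
  · obtain ⟨n, f, hf⟩ := Module.Finite.exists_fin' R X
    exact ⟨ModuleCat.of R (Fin n → R), ModuleCat.ofHom f,
      ModuleCat.projective_of_free (Pi.basisFun R (Fin n)), (ModuleCat.epi_iff_surjective _).2 hf,
      fun _ => inferInstanceAs (Module.Finite R (Fin n → R))⟩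
  · exact ⟨Projective.over X, Projective.π X, inferInstance, inferInstance, fun h' => absurd h' h⟩

/-- A projective module covering `X`, finitely generated if `X` is. -/
def cover (X : ModuleCat.{0} R) : ModuleCat.{0} R := (exists_projective_cover X).choose

/-- The projection from the chosen projective cover. -/
def coverπ (X : ModuleCat.{0} R) : cover X ⟶ X := (exists_projective_cover X).choose_spec.choose

instance (X : ModuleCat.{0} R) : Projective (cover X) :=
  (exists_projective_cover X).choose_spec.choose_spec.1

instance (X : ModuleCat.{0} R) : Epi (coverπ X) :=
  (exists_projective_cover X).choose_spec.choose_spec.2.1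

lemma finite_cover (X : ModuleCat.{0} R) (h : Module.Finite R X) : Module.Finite R (cover X) :=
  (exists_projective_cover X).choose_spec.choose_spec.2.2 h

/-- The iterated syzygies of `X`. -/
def syzygy (X : ModuleCat.{0} R) : ℕ → ModuleCat.{0} R
  | 0 => X
  | n + 1 => Limits.kernel (coverπ (syzygy X n))

/-- The inclusion of a syzygy in the preceding projective cover. -/
def syzygyι (X : ModuleCat.{0} R) (n : ℕ) : syzygy X (n + 1) ⟶ cover (syzygy X n) :=
  Limits.kernel.ι (coverπ (syzygy X n))

instance (X : ModuleCat.{0} R) (n : ℕ) : Mono (syzygyι X n) :=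
  inferInstanceAs (Mono (Limits.kernel.ι _))

lemma syzygyι_comp (X : ModuleCat.{0} R) (n : ℕ) : syzygyι X n ≫ coverπ (syzygy X n) = 0 :=
  Limits.kernel.condition _

lemma finite_syzygy [IsNoetherianRing R] (X : ModuleCat.{0} R) [h : Module.Finite R X] (n : ℕ) :
    Module.Finite R (syzygy X n) := by
  induction n with
  | zero => exact h
  | succ n ih =>
    have := finite_cover _ ih
    exact Module.Finite.of_injective (syzygyι X n).hom
      ((ModuleCat.mono_iff_injective _).1 inferInstance)

/-- The differential of the resolution of `X` by the chosen projective covers. -/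
def syzygyd (X : ModuleCat.{0} R) (n : ℕ) : cover (syzygy X (n + 1)) ⟶ cover (syzygy X n) :=
  coverπ (syzygy X (n + 1)) ≫ syzygyι X n

lemma syzygyd_comp (X : ModuleCat.{0} R) (n : ℕ) : syzygyd X n ≫ coverπ (syzygy X n) = 0 := by
  rw [syzygyd, Category.assoc, syzygyι_comp, Limits.comp_zero]

/-- The complex of the resolution of `X` by the chosen projective covers. -/
def syzygyComplex (X : ModuleCat.{0} R) : ChainComplex (ModuleCat.{0} R) ℕ :=
  ChainComplex.of (fun n => cover (syzygy X n)) (syzygyd X) (fun n => by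
    rw [syzygyd.eq_1 X n, reassoc_of% syzygyd_comp, Limits.zero_comp])

lemma syzygyComplex_d (X : ModuleCat.{0} R) (n : ℕ) :
    (syzygyComplex X).d (n + 1) n = syzygyd X n :=
  ChainComplex.of_d (fun n => cover (syzygy X n)) (syzygyd X) n

lemma syzygy_exact (X : ModuleCat.{0} R) (n : ℕ) :
    (ShortComplex.mk _ _ (syzygyd_comp X n)).Exact := by
  let α : ShortComplex.mk _ _ (syzygyd_comp X n) ⟶ ShortComplex.mk _ _ (syzygyι_comp X n) :=
    { τ₁ := coverπ (syzygy X (n + 1))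
      τ₂ := 𝟙 _
      τ₃ := 𝟙 _ }
  have : Epi α.τ₁ := inferInstanceAs (Epi (coverπ _))
  have : IsIso α.τ₂ := inferInstanceAs (IsIso (𝟙 _))
  have : Mono α.τ₃ := inferInstanceAs (Mono (𝟙 _))
  rw [ShortComplex.exact_iff_of_epi_of_isIso_of_mono α]
  exact ShortComplex.exact_of_f_is_kernel _ (Limits.kernelIsKernel _)

lemma syzygyComplex_exactAt (X : ModuleCat.{0} R) (n : ℕ) :
    (syzygyComplex X).ExactAt (n + 1) := by
  rw [HomologicalComplex.exactAt_iff' _ (n + 1 + 1) (n + 1) n (by simp) (by simp),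
    ShortComplex.moduleCat_exact_iff]
  intro x hx
  have h := syzygy_exact X (n + 1)
  rw [ShortComplex.moduleCat_exact_iff] at h
  have hx' : (syzygyComplex X).d (n + 1) n x = 0 := hx
  rw [syzygyComplex_d] at hx'
  obtain ⟨y, hy⟩ := h x ((ModuleCat.mono_iff_injective (syzygyι X n)).1 inferInstance
    (by rw [map_zero]; exact hx'))
  refine ⟨y, ?_⟩
  change (syzygyComplex X).d (n + 1 + 1) (n + 1) y = x
  rw [syzygyComplex_d]
  exact hy

lemma exists_finite_projectiveResolution [IsNoetherianRing R] (X : ModuleCat.{0} R)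
    [Module.Finite R X] :
    ∃ P : ProjectiveResolution X, ∀ n, Module.Finite R (P.complex.X n) := by
  have w : (syzygyComplex X).d 1 0 ≫ coverπ (syzygy X 0) = 0 := by
    rw [syzygyComplex_d]
    exact syzygyd_comp X 0
  refine ⟨{ complex := syzygyComplex X
            projective := fun n => inferInstanceAs (Projective (cover _))
            π := (ChainComplex.toSingle₀Equiv _ _).symm ⟨coverπ (syzygy X 0), w⟩
            quasiIso := ⟨fun n => ?_⟩ }, fun n => finite_cover _ (finite_syzygy X n)⟩
  cases n
  · rw [ChainComplex.quasiIsoAt₀_iff, ShortComplex.quasiIso_iff_of_zeros']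
    · have h := syzygy_exact X 0
      refine (ShortComplex.exact_and_epi_g_iff_of_iso ?_).2 ⟨h, inferInstanceAs (Epi (coverπ _))⟩
      refine ShortComplex.isoMk (Iso.refl _) (Iso.refl _) (Iso.refl _) ?_ ?_
      · exact (Category.id_comp _).trans ((syzygyComplex_d X 0).symm.trans
          (Category.comp_id _).symm)
      · refine (Category.id_comp _).trans (Eq.trans ?_ (Category.comp_id _).symm)
        exact (ChainComplex.toSingle₀Equiv_symm_apply_f_zero (C := syzygyComplex X)
          (coverπ (syzygy X 0)) w).symm
    all_goals rfl
  · rw [quasiIsoAt_iff_exactAt']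
    · apply syzygyComplex_exactAt
    · apply ChainComplex.exactAt_succ_single_obj

end FiniteResolution

section CharacterExact

open TensorProduct

variable {R : Type} [CommRing R] {A B C M : Type} [AddCommGroup A] [AddCommGroup B]
  [AddCommGroup C] [AddCommGroup M] [Module R A] [Module R B] [Module R C] [Module R M]

lemma CharacterModule.exact_iff (f : A →ₗ[R] B) (g : B →ₗ[R] C) (hfg : g ∘ₗ f = 0) :
    Function.Exact f g ↔ ∀ χ : CharacterModule B, CharacterModule.dual f χ = 0 →
      ∃ ω : CharacterModule C, CharacterModule.dual g ω = χ := by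
  constructor
  · intro h χ hχ
    let g' : (B ⧸ LinearMap.ker g) →ₗ[R] C := (LinearMap.ker g).liftQ g le_rfl
    have hg' : Function.Injective g' := by
      rw [← LinearMap.ker_eq_bot]
      exact Submodule.ker_liftQ_eq_bot _ _ _ le_rfl
    let χ' : CharacterModule (B ⧸ LinearMap.ker g) :=
      QuotientAddGroup.lift (LinearMap.ker g).toAddSubgroup χ (by
        intro b hb
        obtain ⟨a, rfl⟩ := (h b).1 hb
        exact DFunLike.congr_fun hχ a)
    obtain ⟨ω, hω⟩ := CharacterModule.dual_surjective_of_injective g' hg' χ'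
    refine ⟨ω, DFunLike.ext _ _ fun b => ?_⟩
    exact DFunLike.congr_fun hω (Submodule.Quotient.mk b)
  · intro h b
    constructor
    · intro hb
      by_contra hb'
      have hne : (LinearMap.range f).mkQ b ≠ 0 := by
        rw [Submodule.mkQ_apply, Ne, Submodule.Quotient.mk_eq_zero]
        exact hb'
      obtain ⟨c, hc⟩ := CharacterModule.exists_character_apply_ne_zero_of_ne_zero hne
      obtain ⟨ω, hω⟩ := h (CharacterModule.dual (LinearMap.range f).mkQ c) (by
        rw [← LinearMap.comp_apply, ← CharacterModule.dual_comp, LinearMap.range_mkQ_comp,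
          CharacterModule.dual_zero]
        rfl)
      refine hc ?_
      have := DFunLike.congr_fun hω b
      refine this.symm.trans ?_
      change ω (g b) = 0
      rw [hb, map_zero]
    · rintro ⟨a, rfl⟩
      exact DFunLike.congr_fun hfg a

lemma CharacterModule.dual_rTensor_homEquiv (f : A →ₗ[R] B) (φ : B →ₗ[R] CharacterModule M) :
    CharacterModule.dual (f.rTensor M) (CharacterModule.homEquiv φ) =
      CharacterModule.homEquiv (φ ∘ₗ f) := by
  apply (CharacterModule.homEquiv (R := R)).symm.injective
  rw [LinearEquiv.symm_apply_apply]
  rfl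

variable (M) in
lemma rTensor_exact_iff_character (f : A →ₗ[R] B) (g : B →ₗ[R] C) (hfg : g ∘ₗ f = 0) :
    Function.Exact (f.rTensor M) (g.rTensor M) ↔ ∀ φ : B →ₗ[R] CharacterModule M, φ ∘ₗ f = 0 →
      ∃ ψ : C →ₗ[R] CharacterModule M, ψ ∘ₗ g = φ := by
  rw [CharacterModule.exact_iff _ _ (by
    rw [← LinearMap.rTensor_comp, hfg, LinearMap.rTensor_zero])]
  rw [(CharacterModule.homEquiv (R := R) (A := B) (B := M)).surjective.forall]
  refine forall_congr' fun φ => ?_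
  rw [(CharacterModule.homEquiv (R := R) (A := C) (B := M)).surjective.exists]
  simp only [CharacterModule.dual_rTensor_homEquiv, EmbeddingLike.map_eq_zero_iff,
    EmbeddingLike.apply_eq_iff_eq]

/-- For `A` finite projective, `A ⊗ M` is `Hom(A^*, M)`. -/
def tensorEquivDualHom (A M : Type) [AddCommGroup A] [AddCommGroup M] [Module R A] [Module R M]
    [Module.Finite R A] [Module.Projective R A] :
    A ⊗[R] M ≃ₗ[R] (Module.Dual R A →ₗ[R] M) :=
  (LinearEquiv.rTensor M (Module.evalEquiv R A)).trans (dualTensorHomEquiv R (Module.Dual R A) M)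

lemma tensorEquivDualHom_tmul [Module.Finite R A] [Module.Projective R A] (a : A) (m : M)
    (f : Module.Dual R A) : tensorEquivDualHom A M (a ⊗ₜ[R] m) f = f a • m := by
  simp [tensorEquivDualHom]

lemma tensorEquivDualHom_rTensor [Module.Finite R A] [Module.Projective R A] [Module.Finite R B]
    [Module.Projective R B] (f : A →ₗ[R] B) (x : A ⊗[R] M) :
    tensorEquivDualHom B M (f.rTensor M x) = tensorEquivDualHom A M x ∘ₗ f.dualMap := by
  induction x with
  | zero => simp
  | tmul a m => ext; simp [tensorEquivDualHom_tmul]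
  | add x y hx hy => rw [map_add, map_add, hx, hy, map_add, LinearMap.add_comp]

variable (M) in
lemma rTensor_exact_iff_dual [Module.Finite R A] [Module.Projective R A] [Module.Finite R B]
    [Module.Projective R B] [Module.Finite R C] [Module.Projective R C] (f : A →ₗ[R] B)
    (g : B →ₗ[R] C) (hfg : g ∘ₗ f = 0) :
    Function.Exact (f.rTensor M) (g.rTensor M) ↔
      ∀ φ : Module.Dual R B →ₗ[R] M, φ ∘ₗ g.dualMap = 0 →
        ∃ ψ : Module.Dual R A →ₗ[R] M, ψ ∘ₗ f.dualMap = φ := by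
  have hfg' : (g.rTensor M) ∘ₗ (f.rTensor M) = 0 := by
    rw [← LinearMap.rTensor_comp, hfg, LinearMap.rTensor_zero]
  rw [(tensorEquivDualHom B M).surjective.forall]
  refine forall_congr' fun x => ?_
  rw [(tensorEquivDualHom A M).surjective.exists]
  simp only [← tensorEquivDualHom_rTensor,
    EmbeddingLike.map_eq_zero_iff, EmbeddingLike.apply_eq_iff_eq, Set.mem_range]
  refine ⟨fun h => h.1, fun h => ⟨h, ?_⟩⟩
  rintro ⟨y, rfl⟩
  exact LinearMap.congr_fun hfg' y

end CharacterExact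

section TorBridge

open TensorProduct

variable {R : Type} [CommRing R]

/-- The character module, as an object of the category of modules. -/
def charModule (X : ModuleCat.{0} R) : ModuleCat.{0} R := ModuleCat.of R (CharacterModule X)

lemma homExactAt_iff_linearMap (P : ChainComplex (ModuleCat.{0} R) ℕ) (Y : ModuleCat.{0} R)
    (n : ℕ) : HomExactAt P Y n ↔ ∀ φ : P.X n →ₗ[R] Y, φ ∘ₗ (P.d (n + 1) n).hom = 0 →
      ∃ ψ : P.X (n - 1) →ₗ[R] Y, ψ ∘ₗ (P.d n (n - 1)).hom = φ := by
  constructor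
  · intro h φ hφ
    obtain ⟨g, hg⟩ := h (ModuleCat.ofHom φ) (ModuleCat.hom_ext hφ)
    exact ⟨g.hom, congrArg ModuleCat.Hom.hom hg⟩
  · intro h f hf
    obtain ⟨ψ, hψ⟩ := h f.hom (congrArg ModuleCat.Hom.hom hf)
    exact ⟨ModuleCat.ofHom ψ, ModuleCat.hom_ext hψ⟩

lemma ChainComplex.hom_d_comp_d (P : ChainComplex (ModuleCat.{0} R) ℕ) (n : ℕ) :
    (P.d n (n - 1)).hom ∘ₗ (P.d (n + 1) n).hom = 0 :=
  congrArg ModuleCat.Hom.hom (P.d_comp_d (n + 1) n (n - 1))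

lemma homExactAt_charModule_iff (P : ChainComplex (ModuleCat.{0} R) ℕ) (X : ModuleCat.{0} R)
    (n : ℕ) : HomExactAt P (charModule X) n ↔
      Function.Exact ((P.d (n + 1) n).hom.rTensor X) ((P.d n (n - 1)).hom.rTensor X) := by
  rw [homExactAt_iff_linearMap]
  exact (rTensor_exact_iff_character X _ _ (P.hom_d_comp_d n)).symm

lemma subsingleton_torModule_iff (n : ℕ) (X M : ModuleCat.{0} R) :
    Subsingleton (torModule R n X M) ↔ Subsingleton (Abelian.Ext.{0} M (charModule X) n) := by
  have Q := projectiveResolution M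
  have hprev : (ComplexShape.down ℕ).prev n = n + 1 := by simp
  have hnext : (ComplexShape.down ℕ).next n = n - 1 := by cases n <;> simp
  rw [Q.subsingleton_ext_iff, homExactAt_charModule_iff, LinearMap.rTensor_exact_iff_lTensor_exact]
  have : Subsingleton (torModule R n X M) ↔ Limits.IsZero (torModule R n X M) :=
    ModuleCat.isZero_iff_subsingleton.symm
  rw [this]
  have e := Q.isoLeftDerivedObj ((MonoidalCategory.tensoringLeft (ModuleCat.{0} R)).obj X) n
  rw [show Limits.IsZero (torModule R n X M) ↔ _ from e.isZero_iff]
  refine (HomologicalComplex.exactAt_iff_isZero_homology _ _).symm.trans ?_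
  rw [HomologicalComplex.exactAt_iff' _ _ _ _ hprev hnext]
  exact ShortComplex.ShortExact.moduleCat_exact_iff_function_exact _

end TorBridge

section Balance

open TensorProduct

variable {R : Type} [CommRing R]

/-- Swapping the arguments of a pairing with values in the rational circle. -/
def characterFlip {A B : Type} [AddCommGroup A] [AddCommGroup B] [Module R A] [Module R B]
    (f : A →ₗ[R] CharacterModule B) : B →ₗ[R] CharacterModule A :=
  CharacterModule.curry (CharacterModule.dual (TensorProduct.comm R B A).toLinearMap
    (CharacterModule.uncurry f))

/-- The character module functor on morphisms. -/
def charMap {X Y : ModuleCat.{0} R} (f : X ⟶ Y) : charModule Y ⟶ charModule X :=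
  ModuleCat.ofHom (CharacterModule.dual f.hom)

/-- Swapping the arguments of a pairing, as a morphism of modules. -/
def charFlip {X Y : ModuleCat.{0} R} (f : X ⟶ charModule Y) : Y ⟶ charModule X :=
  ModuleCat.ofHom (characterFlip (B := Y) f.hom)

lemma charFlip_charFlip {X Y : ModuleCat.{0} R} (f : X ⟶ charModule Y) :
    charFlip (charFlip f) = f :=
  rfl

lemma charFlip_comp {X Y Z : ModuleCat.{0} R} (f : X ⟶ Y) (g : Y ⟶ charModule Z) :
    charFlip (f ≫ g) = charFlip g ≫ charMap f :=
  rfl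

lemma injective_charModule (Q : ModuleCat.{0} R) [hQ : Projective Q] :
    Injective (charModule Q) := by
  have hproj : Module.Projective R Q := (IsProjective.iff_projective _).2 hQ
  have hflat : Module.Flat R Q := inferInstance
  have := (Module.Flat.iff_characterModule_injective (R := R) (M := Q)).1 hflat
  exact (Module.injective_iff_injective_object R (CharacterModule Q)).1 this

/-- The character dual of a short complex. -/
def charShortComplex (S : ShortComplex (ModuleCat.{0} R)) : ShortComplex (ModuleCat.{0} R) :=
  ShortComplex.mk (charMap S.g) (charMap S.f) (by
    have : charMap S.g ≫ charMap S.f = charMap (S.f ≫ S.g) := rfl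
    rw [this, S.zero]
    exact ModuleCat.hom_ext CharacterModule.dual_zero)

lemma charShortComplex_shortExact {S : ShortComplex (ModuleCat.{0} R)} (hS : S.ShortExact) :
    (charShortComplex S).ShortExact := by
  have := hS.mono_f
  have := hS.epi_g
  refine ModuleCat.shortComplex_shortExact _ ?_ ?_ ?_
  · have h := (CharacterModule.exact_iff S.f.hom S.g.hom
      (congrArg ModuleCat.Hom.hom S.zero)).1
      ((ShortComplex.ShortExact.moduleCat_exact_iff_function_exact S).1 hS.exact)
    intro χ
    refine ⟨fun hχ => h χ hχ, ?_⟩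
    rintro ⟨ω, rfl⟩
    exact LinearMap.congr_fun (congrArg ModuleCat.Hom.hom (charShortComplex S).zero) ω
  · exact CharacterModule.dual_injective_of_surjective _
      ((ModuleCat.epi_iff_surjective _).1 inferInstance)
  · exact CharacterModule.dual_surjective_of_injective _
      ((ModuleCat.mono_iff_injective _).1 inferInstance)

lemma subsingleton_ext_charModule_comm (n : ℕ) (M X : ModuleCat.{0} R) :
    Subsingleton (Abelian.Ext.{0} M (charModule X) n) ↔
      Subsingleton (Abelian.Ext.{0} X (charModule M) n) := by
  induction n using Nat.twoStepInduction generalizing M with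
  | zero =>
    rw [subsingleton_ext_zero_iff, subsingleton_ext_zero_iff]
    exact ⟨fun h f => by rw [← charFlip_charFlip f, h (charFlip f)]; rfl,
      fun h f => by rw [← charFlip_charFlip f, h (charFlip f)]; rfl⟩
  | one =>
    have hS := M.shortExact_projectiveShortComplex
    have : Projective M.projectiveShortComplex.X₂ :=
      ModuleCat.projective_of_free (Module.Free.chooseBasis R M.projectiveShortComplex.X₂)
    have : Injective (charShortComplex M.projectiveShortComplex).X₂ := injective_charModule _
    refine (hS.subsingleton_ext_one_contra_iff (charModule X)).trans
      (Iff.trans ?_ ((charShortComplex_shortExact hS).subsingleton_ext_one_cov_iff X).symm)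
    constructor
    · intro h f
      obtain ⟨g, hg⟩ := h (charFlip f)
      exact ⟨charFlip g, (charFlip_comp _ _).symm.trans (congrArg charFlip hg)⟩
    · intro h f
      obtain ⟨g, hg⟩ := h (charFlip f)
      refine ⟨charFlip g, ?_⟩
      rw [← charFlip_charFlip f, ← hg]
      rfl
  | more n _ ih =>
    have hS := M.shortExact_projectiveShortComplex
    have : Projective M.projectiveShortComplex.X₂ :=
      ModuleCat.projective_of_free (Module.Free.chooseBasis R M.projectiveShortComplex.X₂)
    have : Injective (charShortComplex M.projectiveShortComplex).X₂ := injective_charModule _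
    exact (hS.subsingleton_ext_contra_iff (charModule X) n).trans ((ih _).trans
      ((charShortComplex_shortExact hS).subsingleton_ext_cov_iff X n).symm)

end Balance

section DualComplex

variable {S : Type} [CommRing S] (P : ChainComplex (ModuleCat.{0} S) ℕ)

/-- The coboundaries of the dual of a complex. -/
def dualBoundary (t : ℕ) : Submodule S (Module.Dual S (P.X t)) :=
  LinearMap.range (P.d t (t - 1)).hom.dualMap

/-- The cokernels of the differentials of the dual of a complex. -/
abbrev dualCoker (t : ℕ) : Type := Module.Dual S (P.X t) ⧸ dualBoundary P t

lemma dualMap_comp_dualMap (t : ℕ) :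
    (P.d (t + 1) t).hom.dualMap ∘ₗ (P.d t (t - 1)).hom.dualMap = 0 := by
  rw [LinearMap.dualMap_comp_dualMap, P.hom_d_comp_d, LinearMap.dualMap_eq_lcomp]
  ext; simp

lemma dualBoundary_le_ker (t : ℕ) :
    dualBoundary P t ≤ LinearMap.ker (P.d (t + 1) t).hom.dualMap := by
  rintro _ ⟨x, rfl⟩
  exact LinearMap.congr_fun (dualMap_comp_dualMap P t) x

/-- The map induced by the differential of the dual of a complex on a cokernel. -/
def dualCokerMap (t : ℕ) : dualCoker P t →ₗ[S] Module.Dual S (P.X (t + 1)) :=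
  (dualBoundary P t).liftQ _ (dualBoundary_le_ker P t)

lemma homExactAt_self_iff (t : ℕ) : HomExactAt P (ModuleCat.of S S) t ↔
    LinearMap.ker (P.d (t + 1) t).hom.dualMap ≤ dualBoundary P t := by
  rw [homExactAt_iff_linearMap]
  exact Iff.rfl

lemma range_dualCokerMap (t : ℕ) : LinearMap.range (dualCokerMap P t) = dualBoundary P (t + 1) :=
  Submodule.range_liftQ _ _ _

/-- The short complex `N_t → F_{t+1} → N_{t+1}` built from the dual `F` of a complex and its
cokernels `N`. -/
def dualShortComplex (t : ℕ) : ShortComplex (ModuleCat.{0} S) :=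
  ModuleCat.shortComplexOfCompEqZero (dualCokerMap P t) (dualBoundary P (t + 1)).mkQ (by
    rw [← range_dualCokerMap, LinearMap.range_mkQ_comp])

variable {P}

lemma dualShortComplex_shortExact {t : ℕ} (h : HomExactAt P (ModuleCat.of S S) t) :
    (dualShortComplex P t).ShortExact := by
  refine ModuleCat.shortComplex_shortExact _ ?_ ?_ ?_
  · refine LinearMap.exact_iff.2 ?_
    exact (Submodule.ker_mkQ _).trans (range_dualCokerMap P t).symm
  · refine LinearMap.ker_eq_bot.1 ?_
    exact Submodule.ker_liftQ_eq_bot _ _ _ ((homExactAt_self_iff P t).1 h)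
  · exact Submodule.mkQ_surjective _

lemma projective_dualShortComplex [∀ n, Module.Finite S (P.X n)] [∀ n, Projective (P.X n)]
    (t : ℕ) : Projective (dualShortComplex P t).X₂ := by
  have : Module.Projective S (P.X (t + 1)) := (IsProjective.iff_projective _).2 inferInstance
  exact (IsProjective.iff_projective _).1
    (inferInstanceAs (Module.Projective S (Module.Dual S (P.X (t + 1)))))

variable (P) in
/-- Exactness of `Hom(F, M)` in degree `t`, where `F` is the dual of `P`. -/
def DualHomExactAt (M : ModuleCat.{0} S) (t : ℕ) : Prop :=
  ∀ φ : Module.Dual S (P.X t) →ₗ[S] M, φ ∘ₗ (P.d t (t - 1)).hom.dualMap = 0 →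
    ∃ ψ : Module.Dual S (P.X (t + 1)) →ₗ[S] M, ψ ∘ₗ (P.d (t + 1) t).hom.dualMap = φ

lemma dualHomExactAt_iff_homExactAt_charModule [∀ n, Module.Finite S (P.X n)]
    [∀ n, Projective (P.X n)] (M : ModuleCat.{0} S) (t : ℕ) :
    DualHomExactAt P M t ↔ HomExactAt P (charModule M) t := by
  have (n : ℕ) : Module.Projective S (P.X n) := (IsProjective.iff_projective _).2 inferInstance
  rw [homExactAt_charModule_iff]
  exact (rTensor_exact_iff_dual M _ _ (P.hom_d_comp_d t)).symm

lemma dualHomExactAt_iff_extend (M : ModuleCat.{0} S) (t : ℕ) :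
    DualHomExactAt P M t ↔ ∀ f : (dualShortComplex P t).X₁ ⟶ M,
      ∃ g : (dualShortComplex P t).X₂ ⟶ M, (dualShortComplex P t).f ≫ g = f := by
  constructor
  · intro h f
    let f' : dualCoker P t →ₗ[S] M := f.hom
    obtain ⟨ψ, hψ⟩ := h (f' ∘ₗ (dualBoundary P t).mkQ) (by
      rw [LinearMap.comp_assoc]
      have : (dualBoundary P t).mkQ ∘ₗ (P.d t (t - 1)).hom.dualMap = 0 :=
        LinearMap.range_mkQ_comp _
      rw [this, LinearMap.comp_zero])
    refine ⟨ModuleCat.ofHom ψ, ModuleCat.hom_ext (Submodule.linearMap_qext _ ?_)⟩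
    exact hψ
  · intro h φ hφ
    have hle : dualBoundary P t ≤ LinearMap.ker φ := by
      rintro _ ⟨x, rfl⟩
      exact LinearMap.congr_fun hφ x
    obtain ⟨g, hg⟩ := h (ModuleCat.ofHom ((dualBoundary P t).liftQ φ hle))
    refine ⟨g.hom, ?_⟩
    ext x
    exact LinearMap.congr_fun (congrArg ModuleCat.Hom.hom hg) (Submodule.Quotient.mk x)

lemma subsingleton_ext_dualCoker_iff [∀ n, Module.Finite S (P.X n)] [∀ n, Projective (P.X n)]
    (M : ModuleCat.{0} S) (i j : ℕ)
    (h : ∀ s, i ≤ s → s ≤ i + j → HomExactAt P (ModuleCat.of S S) s) :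
    Subsingleton (Abelian.Ext.{0} (ModuleCat.of S (dualCoker P (i + j + 1))) M (j + 1)) ↔
      DualHomExactAt P M i := by
  induction j with
  | zero =>
    have := projective_dualShortComplex (P := P) i
    exact ((dualShortComplex_shortExact
      (h i le_rfl le_rfl)).subsingleton_ext_one_contra_iff M).trans (dualHomExactAt_iff_extend M i).symm
  | succ j ih =>
    have := projective_dualShortComplex (P := P) (i + j + 1)
    exact ((dualShortComplex_shortExact (h (i + j + 1) (by lia)
      (by lia))).subsingleton_ext_contra_iff M j).trans (ih fun s h₁ h₂ => h s h₁ (by lia))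

lemma subsingleton_ext_dualCoker_of_lt [∀ n, Module.Finite S (P.X n)] [∀ n, Projective (P.X n)]
    (M : ModuleCat.{0} S) (d n : ℕ) (hn : d < n)
    (h : ∀ s < d, HomExactAt P (ModuleCat.of S S) s) :
    Subsingleton (Abelian.Ext.{0} (ModuleCat.of S (dualCoker P d)) M n) := by
  induction d generalizing n with
  | zero =>
    obtain ⟨n, rfl⟩ := Nat.exists_eq_add_of_lt hn
    have : Module.Projective S (P.X 0) := (IsProjective.iff_projective _).2 inferInstance
    have hbot : dualBoundary P 0 = ⊥ := by
      rw [dualBoundary, P.d_zero_zero_sub]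
      refine LinearMap.range_eq_bot.2 ?_
      ext; simp
    have : Module.Projective S (dualCoker P 0) :=
      Module.Projective.of_equiv (Submodule.quotEquivOfEqBot _ hbot).symm
    have : Projective (ModuleCat.of S (dualCoker P 0)) := (IsProjective.iff_projective _).1 this
    rw [zero_add]
    exact subsingleton_of_forall_eq 0 fun x => Abelian.Ext.eq_zero_of_projective x
  | succ d ih =>
    obtain ⟨n, rfl⟩ := Nat.exists_eq_add_of_lt hn
    have := projective_dualShortComplex (P := P) d
    have := ((dualShortComplex_shortExact (h d (by lia))).subsingleton_ext_contra_iff M (d + n)).2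
      (ih _ (by lia) fun s hs => h s (by lia))
    rw [show d + 1 + n + 1 = d + n + 2 by lia]
    exact this

end DualComplex

section LocalTor

variable {S : Type} [CommRing S]

lemma subsingleton_torModule_iff_dualHomExactAt {X : ModuleCat.{0} S} (P : ProjectiveResolution X)
    [∀ n, Module.Finite S (P.complex.X n)] (M : ModuleCat.{0} S) (t : ℕ) :
    Subsingleton (torModule S t X M) ↔ DualHomExactAt P.complex M t := by
  rw [subsingleton_torModule_iff, subsingleton_ext_charModule_comm, P.subsingleton_ext_iff,
    dualHomExactAt_iff_homExactAt_charModule]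

lemma subsingleton_torModule_of_add_lt [IsNoetherianRing S] (X M : ModuleCat.{0} S)
    [Module.Finite S X] {D n t : ℕ}
    (hD : ∀ i < D, Subsingleton (Abelian.Ext.{0} X (ModuleCat.of S S) i))
    (hn : ∀ (N : ModuleCat.{0} S) (i : ℕ), n < i → Subsingleton (Abelian.Ext.{0} N M i))
    (ht : t + n < D) : Subsingleton (torModule S t X M) := by
  obtain ⟨P, hP⟩ := exists_finite_projectiveResolution X
  obtain ⟨j, rfl⟩ := Nat.exists_eq_add_of_lt ht
  rw [subsingleton_torModule_iff_dualHomExactAt P]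
  exact (subsingleton_ext_dualCoker_iff M t (n + j)
    fun s _ hs => (P.subsingleton_ext_iff _ _).1 (hD s (by lia))).1 (hn _ _ (by lia))

lemma CategoryTheory.ProjectiveResolution.exists_d_comp_eq_smul {X Y : ModuleCat.{0} S}
    (P : ProjectiveResolution X) (r : S) (hr : ∀ x : X, r • x = 0) (n : ℕ)
    (f : P.complex.X n ⟶ Y) (hf : P.complex.d (n + 1) n ≫ f = 0) :
    ∃ g : P.complex.X (n - 1) ⟶ Y, P.complex.d n (n - 1) ≫ g = r • f := by
  have hX : r • 𝟙 X = 0 := ModuleCat.hom_ext (LinearMap.ext hr)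
  have hrf : P.complex.d (n + 1) n ≫ (r • f) = 0 := by rw [Linear.comp_smul, hf, smul_zero]
  cases n with
  | zero =>
    obtain ⟨π, _, hπ, hdesc⟩ := P.exists_augmentation
    obtain ⟨g, rfl⟩ := hdesc Y f hf
    refine ⟨0, ?_⟩
    have : r • g = 0 := by
      rw [← Category.id_comp g, ← Linear.smul_comp, hX, Limits.zero_comp]
    rw [Limits.comp_zero, ← Linear.comp_smul, this, Limits.comp_zero]
  | succ p =>
    refine (P.extMk_eq_zero_iff (r • f) (p + 1 + 1) rfl hrf p rfl).1 ?_
    have hf' : r • f = f ≫ (r • 𝟙 Y) := by rw [Linear.comp_smul, Category.comp_id]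
    have key : P.extMk (r • f) (p + 1 + 1) rfl hrf = r • P.extMk f (p + 1 + 1) rfl hf := by
      simp only [hf']
      rw [← P.extMk_comp_mk₀ f (p + 1 + 1) rfl hf (r • 𝟙 Y), Abelian.Ext.mk₀_smul,
        Abelian.Ext.comp_smul, Abelian.Ext.comp_mk₀_id]
    rw [key, ← Abelian.Ext.mk₀_id_comp (P.extMk f (p + 1 + 1) rfl hf), ← Abelian.Ext.smul_comp,
      ← Abelian.Ext.mk₀_smul, hX, Abelian.Ext.mk₀_zero, Abelian.Ext.zero_comp]

/-- A cocycle of the dual of a resolution of the residue field that is not a coboundary spans a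
copy of the residue field in the cokernel of the preceding differential. -/
lemma exists_residueField_to_dualCoker [IsLocalRing S]
    (P : ProjectiveResolution (ModuleCat.of S (IsLocalRing.ResidueField S))) (d : ℕ)
    (h : ¬ HomExactAt P.complex (ModuleCat.of S S) d) :
    ∃ u : IsLocalRing.ResidueField S →ₗ[S] dualCoker P.complex d,
      Function.Injective u ∧ dualCokerMap P.complex d ∘ₗ u = 0 := by
  have h' := h
  rw [homExactAt_self_iff, SetLike.not_le_iff_exists] at h'
  obtain ⟨z, hz, hz'⟩ := h'
  let v : S →ₗ[S] dualCoker P.complex d :=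
    LinearMap.toSpanSingleton S _ ((dualBoundary P.complex d).mkQ z)
  have hv : IsLocalRing.maximalIdeal S = LinearMap.ker v := by
    refine (IsLocalRing.maximalIdeal.isMaximal S).eq_of_le ?_ ?_
    · intro htop
      refine hz' ?_
      have : (1 : S) ∈ LinearMap.ker v := by rw [htop]; trivial
      have : v 1 = 0 := this
      rw [LinearMap.toSpanSingleton_apply, one_smul] at this
      exact (Submodule.Quotient.mk_eq_zero _).1 this
    · intro r hr
      obtain ⟨g, hg⟩ := P.exists_d_comp_eq_smul (Y := ModuleCat.of S S) r (by
        intro x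
        obtain ⟨x, rfl⟩ := IsLocalRing.residue_surjective x
        refine (Ideal.Quotient.eq_zero_iff_mem (I := IsLocalRing.maximalIdeal S)).2 ?_
        exact Ideal.mul_mem_right _ _ hr) d (ModuleCat.ofHom z) (ModuleCat.hom_ext hz)
      refine (Submodule.Quotient.mk_eq_zero (dualBoundary P.complex d) (x := r • z)).2 ?_
      exact ⟨g.hom, congrArg ModuleCat.Hom.hom hg⟩
  refine ⟨(IsLocalRing.maximalIdeal S).liftQ v hv.le, ?_, ?_⟩
  · refine LinearMap.ker_eq_bot.1 ?_
    exact Submodule.ker_liftQ_eq_bot _ _ _ hv.ge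
  · refine Submodule.linearMap_qext _ (LinearMap.ext_ring ?_)
    change dualCokerMap P.complex d (v 1) = 0
    rw [LinearMap.toSpanSingleton_apply, one_smul]
    exact hz

lemma not_subsingleton_torModule_sub [IsNoetherianRing S] [IsLocalRing S] (M : ModuleCat.{0} S)
    {d n : ℕ}
    (hlt : ∀ i < d, Subsingleton (Abelian.Ext.{0} (ModuleCat.of S (IsLocalRing.ResidueField S))
      (ModuleCat.of S S) i))
    (hd : ¬ Subsingleton (Abelian.Ext.{0} (ModuleCat.of S (IsLocalRing.ResidueField S))
      (ModuleCat.of S S) d))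
    (hn : ∀ (N : ModuleCat.{0} S) (i : ℕ), n < i → Subsingleton (Abelian.Ext.{0} N M i))
    (hne : ¬ Subsingleton
      (Abelian.Ext.{0} (ModuleCat.of S (IsLocalRing.ResidueField S)) M n)) :
    n ≤ d ∧ ¬ Subsingleton
      (torModule S (d - n) (ModuleCat.of S (IsLocalRing.ResidueField S)) M) := by
  have : Module.Finite S (ModuleCat.of S (IsLocalRing.ResidueField S)) :=
    inferInstanceAs (Module.Finite S (IsLocalRing.ResidueField S))
  obtain ⟨P, hP⟩ := exists_finite_projectiveResolution
    (ModuleCat.of S (IsLocalRing.ResidueField S))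
  have hlt' : ∀ i < d, HomExactAt P.complex (ModuleCat.of S S) i :=
    fun i hi => (P.subsingleton_ext_iff _ _).1 (hlt i hi)
  rw [P.subsingleton_ext_iff] at hd
  obtain ⟨u, hu, hu'⟩ := exists_residueField_to_dualCoker P d hd
  let T : ShortComplex (ModuleCat.{0} S) := ModuleCat.shortComplexOfCompEqZero u
    (LinearMap.range u).mkQ (LinearMap.range_mkQ_comp u)
  have hT : T.ShortExact := ModuleCat.shortComplex_shortExact _
    (LinearMap.exact_iff.2 (Submodule.ker_mkQ _)) hu (Submodule.mkQ_surjective _)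
  have hsurj := hT.precomp_surjective M n (hn _ _ (by lia))
  have hN : ¬ Subsingleton (Abelian.Ext.{0} (ModuleCat.of S (dualCoker P.complex d)) M n) := by
    intro hs
    refine hne (subsingleton_of_forall_eq 0 fun x => ?_)
    obtain ⟨y, rfl⟩ := hsurj x
    rw [show y = 0 from hs.elim _ _, Abelian.Ext.comp_zero]
  have hnd : n ≤ d := by
    by_contra! hlt''
    exact hN (subsingleton_ext_dualCoker_of_lt M d n hlt'' hlt')
  refine ⟨hnd, ?_⟩
  rw [subsingleton_torModule_iff_dualHomExactAt P]
  cases n with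
  | zero =>
    intro h
    rw [dualHomExactAt_iff_extend] at h
    refine hne (subsingleton_ext_zero_iff.2 fun f => ?_)
    obtain ⟨y, hy⟩ := hsurj (Abelian.Ext.mk₀ f)
    obtain ⟨g, hg⟩ := h (Abelian.Ext.homEquiv₀ y)
    have hf : T.f ≫ Abelian.Ext.homEquiv₀ y = f := by
      refine (Abelian.Ext.mk₀_bijective _ _).1 ?_
      rw [← Abelian.Ext.mk₀_comp_mk₀, Abelian.Ext.mk₀_homEquiv₀_apply, hy]
    refine hf.symm.trans (((congrArg (fun q => T.f ≫ q) hg).symm).trans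
      (ModuleCat.hom_ext (LinearMap.ext fun x => ?_)))
    exact (congrArg g.hom (LinearMap.congr_fun hu' x)).trans (map_zero g.hom)
  | succ j =>
    obtain ⟨i, rfl⟩ := Nat.exists_eq_add_of_le hnd
    rw [show j + 1 + i - (j + 1) = i by lia]
    rw [show j + 1 + i = i + j + 1 by lia] at hN
    exact fun h => hN ((subsingleton_ext_dualCoker_iff M i j
      fun s _ hs => hlt' s (by lia)).2 h)

end LocalTor

section DepthFinite

lemma exists_not_subsingleton_ext_residueField (S : Type) [CommRing S] [IsNoetherianRing S]
    [IsLocalRing S] : ∃ d : ℕ, ¬ Subsingleton (Abelian.Ext.{0}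
      (ModuleCat.of S (IsLocalRing.ResidueField S)) (ModuleCat.of S S) d) := by
  by_contra! h
  have : Module.Finite S (ModuleCat.of S (IsLocalRing.ResidueField S)) :=
    inferInstanceAs (Module.Finite S (IsLocalRing.ResidueField S))
  have hsupp : Module.support S (S ⧸ IsLocalRing.maximalIdeal S) =
      PrimeSpectrum.zeroLocus (IsLocalRing.maximalIdeal S) := by
    rw [Module.support_eq_zeroLocus, Ideal.annihilator_quotient]
  have hdim : ringKrullDim S < ⊤ := ringKrullDim_lt_top
  obtain ⟨n, hn⟩ : ∃ n : ℕ, ringKrullDim S < n := by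
    generalize ringKrullDim S = x at hdim
    induction x with
    | bot => exact ⟨0, WithBot.bot_lt_coe _⟩
    | coe x =>
      induction x with
      | top => exact absurd hdim (lt_irrefl _)
      | coe x => exact ⟨x + 1, by exact_mod_cast Nat.lt_succ_self x⟩
  obtain ⟨rs, hrs, -, hreg⟩ := ModuleCat.exists_isRegular_of_exists_subsingleton_ext
    (IsLocalRing.maximalIdeal S) n (ModuleCat.of S S) (by
      refine lt_top_iff_ne_top.2 fun htop => (IsLocalRing.maximalIdeal.isMaximal S).ne_top ?_
      refine Eq.trans ?_ htop
      exact (Ideal.mul_top _).symm)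
    (ModuleCat.of S (IsLocalRing.ResidueField S))
    hsupp (fun i _ => h i)
  have hdim' := ringKrullDim_add_length_eq_ringKrullDim_of_isRegular rs hreg
  have : Nontrivial (S ⧸ Ideal.ofList rs) := by
    refine Ideal.Quotient.nontrivial_iff.2 fun htop => hreg.2 ?_
    rw [htop]
    exact (Submodule.top_smul _).symm
  rw [← hdim', hrs] at hn
  refine absurd hn (not_lt.2 ?_)
  exact le_add_of_nonneg_left ringKrullDim_nonneg_of_nontrivial

end DepthFinite

section CyclicModules

variable {R : Type} [CommRing R]

lemma exists_shortExact_injective (M : ModuleCat.{0} R) : ∃ T : ShortComplex (ModuleCat.{0} R),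
    T.ShortExact ∧ Injective T.X₂ ∧ T.X₁ = M := by
  obtain ⟨J, hJ, f, hf⟩ := (EnoughInjectives.presentation M).some
  exact ⟨ShortComplex.mk f (Limits.cokernel.π f) (Limits.cokernel.condition f),
    { exact := ShortComplex.exact_cokernel f }, hJ, rfl⟩

/-- The short complex `I → R → R ⧸ I`. -/
def idealShortComplex (I : Ideal R) : ShortComplex (ModuleCat.{0} R) :=
  ModuleCat.shortComplexOfCompEqZero I.subtype I.mkQ (by
    ext x
    exact (Submodule.Quotient.mk_eq_zero I).2 x.2)

lemma idealShortComplex_shortExact (I : Ideal R) : (idealShortComplex I).ShortExact :=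
  ModuleCat.shortComplex_shortExact _ (LinearMap.exact_subtype_mkQ I) I.injective_subtype
    I.mkQ_surjective

lemma subsingleton_ext_of_forall_ideal (M : ModuleCat.{0} R) (n : ℕ)
    (h : ∀ I : Ideal R, Subsingleton (Abelian.Ext.{0} (ModuleCat.of R (R ⧸ I)) M n))
    (N : ModuleCat.{0} R) : Subsingleton (Abelian.Ext.{0} N M n) := by
  induction n using Nat.twoStepInduction generalizing M with
  | zero =>
    have h0 := subsingleton_ext_zero_iff.1 (h ⊥)
    have hM (m : M) : m = 0 := by
      have := LinearMap.congr_fun (congrArg ModuleCat.Hom.hom (h0 (ModuleCat.ofHom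
        ((⊥ : Ideal R).liftQ (LinearMap.toSpanSingleton R M m) bot_le))))
        (Submodule.Quotient.mk 1)
      exact (one_smul R m).symm.trans this
    exact subsingleton_ext_zero_iff.2 fun f => ModuleCat.hom_ext (LinearMap.ext fun x => hM _)
  | one =>
    have hB : Module.Baer R M := by
      intro I g
      have : Projective (idealShortComplex I).X₂ :=
        ModuleCat.projective_of_free (Module.Basis.singleton Unit R)
      obtain ⟨g', hg'⟩ := ((idealShortComplex_shortExact I).subsingleton_ext_one_contra_iff M).1
        (h I) (ModuleCat.ofHom g)
      exact ⟨g'.hom, fun x hx =>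
        LinearMap.congr_fun (congrArg ModuleCat.Hom.hom hg') (⟨x, hx⟩ : I)⟩
    have : Injective M := (Module.injective_iff_injective_object R M).1 hB.injective
    exact subsingleton_of_forall_eq 0 fun x => Abelian.Ext.eq_zero_of_injective x
  | more n _ ih =>
    obtain ⟨T, hT, hinj, rfl⟩ := exists_shortExact_injective M
    rw [hT.subsingleton_ext_cov_iff]
    exact ih _ fun I => (hT.subsingleton_ext_cov_iff _ n).1 (h I)

/-- Multiplication by `a`, as a map `R ⧸ J → R ⧸ I`. -/
def quotMul (I J : Ideal R) (a : R) (h : ∀ r ∈ J, a * r ∈ I) : (R ⧸ J) →ₗ[R] (R ⧸ I) :=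
  J.mapQ I (LinearMap.mulLeft R a) h

/-- The short complex `R ⧸ (I : a) → R ⧸ I → R ⧸ (I + a)`. -/
def colonShortComplex (I J : Ideal R) (a : R) (h : ∀ r ∈ J, a * r ∈ I) :
    ShortComplex (ModuleCat.{0} R) :=
  ModuleCat.shortComplexOfCompEqZero (quotMul I J a h)
    (Submodule.factor (le_sup_left : I ≤ I ⊔ Ideal.span {a})) (by
      refine Submodule.linearMap_qext _ (LinearMap.ext fun r => ?_)
      exact (Submodule.Quotient.mk_eq_zero (I ⊔ Ideal.span {a})).2
        (Ideal.mem_sup_right (Ideal.mul_mem_right _ _ (Ideal.mem_span_singleton_self a))))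

lemma colonShortComplex_shortExact (I J : Ideal R) (a : R) (h : ∀ r, r ∈ J ↔ a * r ∈ I) :
    (colonShortComplex I J a fun r => (h r).1).ShortExact := by
  refine ModuleCat.shortComplex_shortExact _ ?_ ?_ 
    (Submodule.factor_surjective (le_sup_left : I ≤ I ⊔ Ideal.span {a}))
  · intro x
    refine ⟨fun hx => ?_, ?_⟩
    · obtain ⟨x, rfl⟩ := Submodule.Quotient.mk_surjective _ x
      have hx' : x ∈ I ⊔ Ideal.span {a} := (Submodule.Quotient.mk_eq_zero _).1 hx
      obtain ⟨i, hi, y, hy, rfl⟩ := Submodule.mem_sup.1 hx'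
      obtain ⟨r, rfl⟩ := Ideal.mem_span_singleton.1 hy
      refine ⟨Submodule.Quotient.mk r, ?_⟩
      refine (Submodule.Quotient.eq I).2 ?_
      have : LinearMap.mulLeft R a r - (i + a * r) = -i := by simp
      rw [this]
      exact I.neg_mem hi
    · rintro ⟨y, rfl⟩
      exact LinearMap.congr_fun (congrArg ModuleCat.Hom.hom
        (colonShortComplex I J a fun r => (h r).1).zero) y
  · refine LinearMap.ker_eq_bot.1 (LinearMap.ker_eq_bot'.2 fun x hx => ?_)
    obtain ⟨x, rfl⟩ := Submodule.Quotient.mk_surjective _ x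
    exact (Submodule.Quotient.mk_eq_zero J).2
      ((h x).2 ((Submodule.Quotient.mk_eq_zero I).1 hx))

lemma exists_prime_smul_ne_zero [IsNoetherianRing R] (M : ModuleCat.{0} R) (n : ℕ)
    (h : ∃ N : ModuleCat.{0} R, ¬ Subsingleton (Abelian.Ext.{0} N M n)) :
    ∃ p : Ideal R, p.IsPrime ∧ ∃ x : Abelian.Ext.{0} (ModuleCat.of R (R ⧸ p)) M n,
      ∀ a ∉ p, a • x ≠ 0 := by
  obtain ⟨N, hN⟩ := h
  obtain ⟨I, hI⟩ : ∃ I : Ideal R,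
      ¬ Subsingleton (Abelian.Ext.{0} (ModuleCat.of R (R ⧸ I)) M n) :=
    not_forall.1 fun h => hN (subsingleton_ext_of_forall_ideal M n h N)
  obtain ⟨p, hp, hmax⟩ : ∃ p : Ideal R,
      ¬ Subsingleton (Abelian.Ext.{0} (ModuleCat.of R (R ⧸ p)) M n) ∧ ∀ I : Ideal R,
        ¬ Subsingleton (Abelian.Ext.{0} (ModuleCat.of R (R ⧸ I)) M n) → ¬ p < I :=
    set_has_maximal_iff_noetherian.2 ‹IsNoetherianRing R› {I : Ideal R | ¬ Subsingleton
      (Abelian.Ext.{0} (ModuleCat.of R (R ⧸ I)) M n)} ⟨I, hI⟩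
  have hgt (I : Ideal R) (hI : p < I) :
      Subsingleton (Abelian.Ext.{0} (ModuleCat.of R (R ⧸ I)) M n) := by
    by_contra hI'
    exact hmax I hI' hI
  have hinj (a : R) (ha : a ∉ p) (J : Ideal R) (hJ : ∀ r, r ∈ J ↔ a * r ∈ p)
      (x : Abelian.Ext.{0} (ModuleCat.of R (R ⧸ p)) M n)
      (hx : (Abelian.Ext.mk₀ (ModuleCat.ofHom (quotMul p J a fun r => (hJ r).1))).comp x
        (zero_add n) = 0) : x = 0 := by
    obtain ⟨y, rfl⟩ := Abelian.Ext.contravariant_sequence_exact₂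
      (colonShortComplex_shortExact p J a hJ) M x hx
    have := hgt (p ⊔ Ideal.span {a}) (lt_of_le_of_ne le_sup_left fun he =>
      ha (he ▸ Ideal.mem_sup_right (Ideal.mem_span_singleton_self a)))
    obtain rfl : y = 0 := this.elim _ _
    rw [Abelian.Ext.comp_zero]
    rfl
  have hprime : p.IsPrime := by
    refine Ideal.isPrime_iff.2 ⟨?_, fun {a b} hab => ?_⟩
    · rintro rfl
      refine hp (subsingleton_of_forall_eq 0 fun x => ?_)
      have : 𝟙 (ModuleCat.of R (R ⧸ (⊤ : Ideal R))) = 0 :=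
        ModuleCat.hom_ext (LinearMap.ext fun x => Subsingleton.elim (α := R ⧸ (⊤ : Ideal R)) _ _)
      rw [← Abelian.Ext.mk₀_id_comp x, this, Abelian.Ext.mk₀_zero, Abelian.Ext.zero_comp]
    · by_contra! hcon
      refine hp (subsingleton_of_forall_eq 0 fun x => ?_)
      let J : Ideal R := Submodule.comap (LinearMap.mulLeft R a) p
      have hlt : p < J := lt_of_le_of_ne (fun r hr => p.mul_mem_left a hr) fun he =>
        hcon.2 (he ▸ hab)
      have := hgt J hlt
      exact hinj a hcon.1 J (fun r => Iff.rfl) x (this.elim _ _)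
  refine ⟨p, hprime, ?_⟩
  have : Nontrivial (Abelian.Ext.{0} (ModuleCat.of R (R ⧸ p)) M n) :=
    not_subsingleton_iff_nontrivial.1 hp
  obtain ⟨x, hx⟩ := exists_ne (0 : Abelian.Ext.{0} (ModuleCat.of R (R ⧸ p)) M n)
  refine ⟨x, fun a ha hax => hx (hinj a ha p (fun r => ?_) x ?_)⟩
  · exact ⟨fun hr => p.mul_mem_left a hr, fun hr => (hprime.mem_or_mem hr).resolve_left ha⟩
  · have hmul : ModuleCat.ofHom (quotMul p p a fun r hr => p.mul_mem_left a hr) =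
        a • 𝟙 (ModuleCat.of R (R ⧸ p)) :=
      ModuleCat.hom_ext (Submodule.linearMap_qext _ (LinearMap.ext fun r => rfl))
    refine (congrArg (fun q => (Abelian.Ext.mk₀ q).comp x (zero_add n)) hmul).trans ?_
    rw [Abelian.Ext.mk₀_smul, Abelian.Ext.smul_comp, Abelian.Ext.mk₀_id_comp, hax]

end CyclicModules

section LocalizeExt

variable {R : Type} [CommRing R] (p : Ideal R) [p.IsPrime]

/-- The residue field at `p`, as an object of the category of modules over the local ring. -/
abbrev resFieldModule : ModuleCat.{0} (Localization.AtPrime p) :=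
  ModuleCat.of (Localization.AtPrime p) (IsLocalRing.ResidueField (Localization.AtPrime p))

variable {p}

lemma exists_hom_of_smul_eq_zero (N : ModuleCat.{0} R) (c : N) (hc : ∀ r ∈ p, r • c = 0) :
    ∃ f : resFieldModule p ⟶ N.localizedModule p.primeCompl,
      f.hom (IsLocalRing.residue (Localization.AtPrime p) 1) =
        N.localizedModuleMkLinearMap p.primeCompl c := by
  let v : Localization.AtPrime p →ₗ[Localization.AtPrime p] N.localizedModule p.primeCompl :=
    LinearMap.toSpanSingleton _ _ (N.localizedModuleMkLinearMap p.primeCompl c)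
  have hv : IsLocalRing.maximalIdeal (Localization.AtPrime p) ≤ LinearMap.ker v := by
    rw [← Localization.AtPrime.map_eq_maximalIdeal]
    refine Ideal.map_le_iff_le_comap.2 fun r hr => ?_
    change algebraMap R (Localization p.primeCompl) r •
      N.localizedModuleMkLinearMap p.primeCompl c = 0
    rw [algebraMap_smul, ← map_smul, hc r hr, map_zero]
  refine ⟨ModuleCat.ofHom ((IsLocalRing.maximalIdeal (Localization.AtPrime p)).liftQ v hv), ?_⟩
  exact one_smul (Localization.AtPrime p) (N.localizedModuleMkLinearMap p.primeCompl c)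

lemma exists_of_hom [IsNoetherianRing R] (N : ModuleCat.{0} R)
    (f : resFieldModule p ⟶ N.localizedModule p.primeCompl) :
    ∃ c : N, (∀ r ∈ p, r • c = 0) ∧ ∃ s ∉ p,
      s • f.hom (IsLocalRing.residue (Localization.AtPrime p) 1) =
        N.localizedModuleMkLinearMap p.primeCompl c := by
  set y : N.localizedModule p.primeCompl :=
    f.hom (IsLocalRing.residue (Localization.AtPrime p) 1) with hy
  obtain ⟨⟨c, s⟩, hcs⟩ := IsLocalizedModule.mk'_surjective p.primeCompl
    (N.localizedModuleMkLinearMap p.primeCompl) y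
  have hcs' : (s : R) • y = N.localizedModuleMkLinearMap p.primeCompl c := by
    rw [← hcs]
    exact IsLocalizedModule.mk'_cancel' (N.localizedModuleMkLinearMap p.primeCompl) c s
  have hpy : ∀ r ∈ p, r • y = 0 := by
    intro r hr
    rw [← algebraMap_smul (Localization p.primeCompl) r y, hy]
    refine (map_smul f.hom _ _).symm.trans ?_
    have : algebraMap R (Localization p.primeCompl) r •
        IsLocalRing.residue (Localization.AtPrime p) 1 = 0 := by
      refine (Ideal.Quotient.eq_zero_iff_mem
        (I := IsLocalRing.maximalIdeal (Localization.AtPrime p))).2 ?_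
      rw [← Localization.AtPrime.map_eq_maximalIdeal]
      exact Ideal.mul_mem_right _ _ (Ideal.mem_map_of_mem _ hr)
    exact (congrArg f.hom this).trans (map_zero f.hom)
  have hfin : Module.Finite R p := inferInstance
  obtain ⟨u, hu⟩ := Module.Finite.exists_smul_of_comp_eq_of_isLocalizedModule p.primeCompl
    (N.localizedModuleMkLinearMap p.primeCompl)
    ((LinearMap.toSpanSingleton R N c) ∘ₗ (Submodule.subtype p)) 0 (by
      refine LinearMap.ext fun r =>
        Eq.trans ?_ (map_zero (N.localizedModuleMkLinearMap p.primeCompl)).symm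
      change N.localizedModuleMkLinearMap p.primeCompl ((r : R) • c) = 0
      rw [map_smul, ← hcs', smul_comm, hpy r r.2, smul_zero])
  refine ⟨(u : R) • c, fun r hr => ?_, (u : R) * s, (u * s).2, ?_⟩
  · rw [smul_comm]
    have := LinearMap.congr_fun hu ⟨r, hr⟩
    refine this.trans ?_
    exact smul_zero u
  · rw [mul_smul, hcs', map_smul]

lemma smul_hom_one_eq_zero {I : Ideal R} {N : ModuleCat.{0} R}
    (f : ModuleCat.of R (R ⧸ I) ⟶ N) : ∀ r ∈ I, r • f.hom (Submodule.Quotient.mk 1) = 0 := by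
  intro r hr
  refine (map_smul f.hom _ _).symm.trans ?_
  have : r • (Submodule.Quotient.mk 1 : R ⧸ I) = 0 :=
    (Submodule.Quotient.mk_eq_zero I (x := r • (1 : R))).2 (I.mul_mem_right _ hr)
  exact (congrArg f.hom this).trans (map_zero f.hom)

lemma localizedModuleMap_mk (S : Submonoid R) {N N' : ModuleCat.{0} R} (f : N ⟶ N') (x : N) :
    (ModuleCat.localizedModuleMap S f).hom (N.localizedModuleMkLinearMap S x) =
      N'.localizedModuleMkLinearMap S (f.hom x) :=
  IsLocalizedModule.map_apply S (N.localizedModuleMkLinearMap S)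
    (N'.localizedModuleMkLinearMap S) f.hom x

lemma not_subsingleton_ext_localizedModule [IsNoetherianRing R] (M : ModuleCat.{0} R) (n : ℕ)
    (h : ∃ x : Abelian.Ext.{0} (ModuleCat.of R (R ⧸ p)) M n, ∀ a ∉ p, a • x ≠ 0) :
    ¬ Subsingleton (Abelian.Ext.{0} (resFieldModule p) (M.localizedModule p.primeCompl) n) := by
  induction n using Nat.twoStepInduction generalizing M with
  | zero =>
    obtain ⟨x, hx⟩ := h
    let f : ModuleCat.of R (R ⧸ p) ⟶ M := Abelian.Ext.homEquiv₀ x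
    let c : M := f.hom (Submodule.Quotient.mk 1)
    have hf (a : R) (hfa : a • c = 0) : a • f = 0 := by
      refine ModuleCat.hom_ext (Submodule.linearMap_qext _ (LinearMap.ext_ring ?_))
      exact hfa
    obtain ⟨g, hg⟩ := exists_hom_of_smul_eq_zero M c (smul_hom_one_eq_zero f)
    intro hs
    rw [subsingleton_ext_zero_iff.1 hs g] at hg
    obtain ⟨u, hu⟩ := (IsLocalizedModule.eq_zero_iff p.primeCompl
      (M.localizedModuleMkLinearMap p.primeCompl)).1 hg.symm
    refine hx u u.2 ?_
    rw [← Abelian.Ext.mk₀_homEquiv₀_apply x, ← Abelian.Ext.mk₀_smul, hf u hu,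
      Abelian.Ext.mk₀_zero]
  | one =>
    obtain ⟨x, hx⟩ := h
    obtain ⟨T, hT, hinj, rfl⟩ := exists_shortExact_injective M
    have hT' := hT.map_of_exact (ModuleCat.localizedModuleFunctor p.primeCompl)
    have : Injective (T.map (ModuleCat.localizedModuleFunctor p.primeCompl)).X₂ :=
      (ModuleCat.localizedModuleFunctor p.primeCompl).injective_obj _
    intro hs
    obtain ⟨y, rfl⟩ := Abelian.Ext.covariant_sequence_exact₁ _ hT x
      (Abelian.Ext.eq_zero_of_injective _) (n₀ := 0) (by lia)
    let f : ModuleCat.of R (R ⧸ p) ⟶ T.X₃ := Abelian.Ext.homEquiv₀ y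
    obtain ⟨g, hg⟩ := exists_hom_of_smul_eq_zero T.X₃ _ (smul_hom_one_eq_zero f)
    obtain ⟨g', hg'⟩ := (hT'.subsingleton_ext_one_cov_iff (resFieldModule p)).1 hs g
    obtain ⟨i, hi, s, hs, hsi⟩ := exists_of_hom T.X₂ g'
    have heq : T.X₃.localizedModuleMkLinearMap p.primeCompl (T.g.hom i) =
        T.X₃.localizedModuleMkLinearMap p.primeCompl (s • f.hom (Submodule.Quotient.mk 1)) := by
      rw [map_smul, ← hg, ← localizedModuleMap_mk, ← hsi,
        ← algebraMap_smul (Localization p.primeCompl) s, ← algebraMap_smul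
          (Localization p.primeCompl) s (g.hom _)]
      refine (map_smul (ModuleCat.localizedModuleMap p.primeCompl T.g).hom _ _).trans ?_
      exact congrArg _ (LinearMap.congr_fun (congrArg ModuleCat.Hom.hom hg') _)
    obtain ⟨v, hv⟩ := IsLocalizedModule.exists_of_eq (S := p.primeCompl) heq
    let l : (R ⧸ p) →ₗ[R] T.X₂ := p.liftQ (LinearMap.toSpanSingleton R T.X₂ ((v : R) • i))
      fun r hr => by
        change r • (v : R) • i = 0
        rw [smul_comm, hi r hr, smul_zero]
    have hl : ModuleCat.ofHom l ≫ T.g = ((v : R) * s) • f := by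
      refine ModuleCat.hom_ext (Submodule.linearMap_qext _ (LinearMap.ext_ring ?_))
      change T.g.hom ((1 : R) • (v : R) • i) =
        ((v : R) * s) • f.hom (Submodule.Quotient.mk 1)
      rw [one_smul, map_smul, mul_smul]
      exact hv
    refine hx ((v : R) * s) (p.primeCompl.mul_mem v.2 hs) ?_
    rw [← Abelian.Ext.smul_comp, ← Abelian.Ext.mk₀_homEquiv₀_apply y, ← Abelian.Ext.mk₀_smul,
      ← show _ = ((v : R) * s) • Abelian.Ext.homEquiv₀ y from hl, ← Abelian.Ext.mk₀_comp_mk₀,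
      Abelian.Ext.comp_assoc_of_second_deg_zero, hT.comp_extClass, Abelian.Ext.comp_zero]
  | more n _ ih =>
    obtain ⟨x, hx⟩ := h
    obtain ⟨T, hT, hinj, rfl⟩ := exists_shortExact_injective M
    have hT' := hT.map_of_exact (ModuleCat.localizedModuleFunctor p.primeCompl)
    have : Injective (T.map (ModuleCat.localizedModuleFunctor p.primeCompl)).X₂ :=
      (ModuleCat.localizedModuleFunctor p.primeCompl).injective_obj _
    intro hs
    refine ih T.X₃ ?_ ((hT'.subsingleton_ext_cov_iff (resFieldModule p) n).1 hs)
    obtain ⟨y, rfl⟩ := Abelian.Ext.covariant_sequence_exact₁ _ hT x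
      (Abelian.Ext.eq_zero_of_injective _) (n₀ := n + 1) (by lia)
    refine ⟨y, fun a ha hay => hx a ha ?_⟩
    rw [← Abelian.Ext.smul_comp, hay, Abelian.Ext.zero_comp]

end LocalizeExt

section Chouinard

variable {S : Type} [CommRing S]

lemma edepth_eq_of_isLeast (k M : ModuleCat.{0} S) (d : ℕ)
    (hlt : ∀ i < d, Subsingleton (Abelian.Ext.{0} k M i))
    (hd : ¬ Subsingleton (Abelian.Ext.{0} k M d)) : edepth S k M = d := by
  refine IsLeast.csInf_eq ⟨⟨d, rfl, (nontrivial_extModule_iff d k M).2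
    (not_subsingleton_iff_nontrivial.1 hd)⟩, ?_⟩
  rintro x ⟨i, rfl, hi⟩
  by_contra! hlt'
  exact not_subsingleton_iff_nontrivial.2 ((nontrivial_extModule_iff i k M).1 hi)
    (hlt i (by exact_mod_cast hlt'))

lemma ewidth_le {k M : ModuleCat.{0} S} {t : ℕ} (ht : ¬ Subsingleton (torModule S t k M)) :
    ewidth S k M ≤ t :=
  sInf_le ⟨t, rfl, not_subsingleton_iff_nontrivial.1 ht⟩

lemma exists_ewidth_eq_or_eq_top (k M : ModuleCat.{0} S) :
    (∃ t : ℕ, ewidth S k M = t ∧ ¬ Subsingleton (torModule S t k M)) ∨ ewidth S k M = ⊤ := by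
  by_cases h : ∃ t, Nontrivial (torModule S t k M)
  · classical
    refine Or.inl ⟨Nat.find h, IsLeast.csInf_eq ⟨⟨_, rfl, Nat.find_spec h⟩, ?_⟩,
      not_subsingleton_iff_nontrivial.2 (Nat.find_spec h)⟩
    rintro x ⟨i, rfl, hi⟩
    exact_mod_cast Nat.find_min' h hi
  · refine Or.inr (sInf_eq_top.2 ?_)
    rintro x ⟨i, -, hi⟩
    exact (h ⟨i, hi⟩).elim

lemma ewidth_congr (k : ModuleCat.{0} S) {M M' : ModuleCat.{0} S} (e : M ≅ M') :
    ewidth S k M = ewidth S k M' := by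
  have (i : ℕ) : Nontrivial (torModule S i k M) ↔ Nontrivial (torModule S i k M') :=
    (((Tor (ModuleCat.{0} S) i).obj k).mapIso e).toLinearEquiv.toEquiv.nontrivial_congr
  simp only [ewidth, this]

/-- The two models of the localization of a module are isomorphic. -/
def localizedModuleIso (T : Submonoid S) (M : ModuleCat.{0} S) :
    M.localizedModule T ≅ ModuleCat.of (Localization T) (LocalizedModule T M) :=
  (LinearEquiv.extendScalarsOfIsLocalization T (Localization T)
    (IsLocalizedModule.linearEquiv T (M.localizedModuleMkLinearMap T)
      (LocalizedModule.mkLinearMap T M))).toModuleIso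

lemma subsingleton_ext_localizedModule_of_lt [IsNoetherianRing S] (T : Submonoid S)
    (M : ModuleCat.{0} S) (n : ℕ)
    (hn : ∀ (N : ModuleCat.{0} S) (i : ℕ), n < i → Subsingleton (Abelian.Ext.{0} N M i))
    (N : ModuleCat.{0} (Localization T)) (i : ℕ) (hi : n < i) :
    Subsingleton (Abelian.Ext.{0} N (M.localizedModule T) i) := by
  have : HasInjectiveDimensionLE M n := (hasInjectiveDimensionLT_iff.{0} M (n + 1)).2
    fun i hi N e => (hn N i hi).elim e 0
  have := M.localizedModule_hasInjectiveDimensionLE n T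
  exact subsingleton_of_forall_eq 0 fun e =>
    e.eq_zero_of_hasInjectiveDimensionLT (n + 1) hi

lemma exists_edepth_residueField_eq (S : Type) [CommRing S] [IsNoetherianRing S]
    [IsLocalRing S] : ∃ d : ℕ,
      (∀ i < d, Subsingleton (Abelian.Ext.{0} (ModuleCat.of S (IsLocalRing.ResidueField S))
        (ModuleCat.of S S) i)) ∧
      ¬ Subsingleton (Abelian.Ext.{0} (ModuleCat.of S (IsLocalRing.ResidueField S))
        (ModuleCat.of S S) d) ∧
      edepth S (ModuleCat.of S (IsLocalRing.ResidueField S)) (ModuleCat.of S S) = d := by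
  classical
  have h := exists_not_subsingleton_ext_residueField S
  have hmin := fun i (hi : i < Nat.find h) => not_not.1 (Nat.find_min h hi)
  exact ⟨Nat.find h, hmin, Nat.find_spec h, edepth_eq_of_isLeast _ _ _ hmin (Nat.find_spec h)⟩

lemma edepth_sub_ewidth_le [IsNoetherianRing S] [IsLocalRing S] (M : ModuleCat.{0} S) (n : ℕ)
    (hn : ∀ (N : ModuleCat.{0} S) (i : ℕ), n < i → Subsingleton (Abelian.Ext.{0} N M i)) :
    edepth S (ModuleCat.of S (IsLocalRing.ResidueField S)) (ModuleCat.of S S) -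
      ewidth S (ModuleCat.of S (IsLocalRing.ResidueField S)) M ≤ n := by
  obtain ⟨d, hlt, -, hd⟩ := exists_edepth_residueField_eq S
  rcases exists_ewidth_eq_or_eq_top (ModuleCat.of S (IsLocalRing.ResidueField S)) M with
    ⟨t, ht, hne⟩ | ht
  · have : Module.Finite S (ModuleCat.of S (IsLocalRing.ResidueField S)) :=
      inferInstanceAs (Module.Finite S (IsLocalRing.ResidueField S))
    have hle : d ≤ t + n := by
      by_contra! h
      exact hne (subsingleton_torModule_of_add_lt _ M hlt hn h)
    rw [hd, ht]
    refine EReal.sub_le_of_le_add ?_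
    rw [add_comm]
    exact_mod_cast hle
  · rw [ht, EReal.sub_top]
    exact bot_le

lemma le_edepth_sub_ewidth [IsNoetherianRing S] [IsLocalRing S] (M : ModuleCat.{0} S) (n : ℕ)
    (hn : ∀ (N : ModuleCat.{0} S) (i : ℕ), n < i → Subsingleton (Abelian.Ext.{0} N M i))
    (hne : ¬ Subsingleton
      (Abelian.Ext.{0} (ModuleCat.of S (IsLocalRing.ResidueField S)) M n)) :
    (n : EReal) ≤ edepth S (ModuleCat.of S (IsLocalRing.ResidueField S)) (ModuleCat.of S S) -
      ewidth S (ModuleCat.of S (IsLocalRing.ResidueField S)) M := by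
  obtain ⟨d, hlt, hd', hd⟩ := exists_edepth_residueField_eq S
  obtain ⟨hnd, ht⟩ := not_subsingleton_torModule_sub M hlt hd' hn hne
  rw [hd]
  refine le_trans ?_ (EReal.sub_le_sub le_rfl (ewidth_le ht))
  obtain ⟨t, rfl⟩ := Nat.exists_eq_add_of_le hnd
  rw [Nat.add_sub_cancel_left, Nat.cast_add]
  exact EReal.add_sub_cancel_right (b := (t : ℝ)) |>.ge

lemma ewidth_eq_top_of_subsingleton (k M : ModuleCat.{0} S) [Subsingleton M] :
    ewidth S k M = ⊤ := by
  refine (exists_ewidth_eq_or_eq_top k M).resolve_left ?_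
  rintro ⟨t, -, ht⟩
  refine ht ((subsingleton_torModule_iff t k M).2 (subsingleton_of_forall_eq 0 fun x => ?_))
  have : 𝟙 M = 0 := ModuleCat.hom_ext (LinearMap.ext fun x => Subsingleton.elim _ _)
  rw [← Abelian.Ext.mk₀_id_comp x, this, Abelian.Ext.mk₀_zero, Abelian.Ext.zero_comp]

lemma einjDim_eq_of_isGreatest (M : ModuleCat.{0} S) (n : ℕ)
    (hn : ∀ (N : ModuleCat.{0} S) (i : ℕ), n < i → Subsingleton (Abelian.Ext.{0} N M i))
    (hne : ∃ N : ModuleCat.{0} S, ¬ Subsingleton (Abelian.Ext.{0} N M n)) :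
    einjDim S M = n := by
  obtain ⟨N, hN⟩ := hne
  refine IsGreatest.csSup_eq ⟨⟨n, N, rfl, (nontrivial_extModule_iff n N M).2
    (not_subsingleton_iff_nontrivial.1 hN)⟩, ?_⟩
  rintro x ⟨i, N', rfl, hi⟩
  by_contra! hlt
  exact not_subsingleton_iff_nontrivial.2 ((nontrivial_extModule_iff i N' M).1 hi)
    (hn N' i (by exact_mod_cast hlt))

end Chouinard

/-- Chouinard's formula. For `M` of finite injective dimension,
`inj dim_R M = sup_{p} ( depth R_p - width_{R_p} M_p )`. -/
theorem injDim_eq_sup_depth_sub_width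
    (R : Type) [CommRing R] [IsNoetherianRing R]
    (M : Type) [AddCommGroup M] [Module R M]
    (hfin : ∃ n : ℕ, ∀ (N : ModuleCat R) (i : ℕ), n < i →
      Subsingleton (extModule R i N (ModuleCat.of R M))) :
    einjDim R (ModuleCat.of R M)
      = ⨆ p : PrimeSpectrum R,
          (edepth (Localization.AtPrime p.asIdeal)
              (ModuleCat.of (Localization.AtPrime p.asIdeal)
                (IsLocalRing.ResidueField (Localization.AtPrime p.asIdeal)))
              (ModuleCat.of (Localization.AtPrime p.asIdeal) (Localization.AtPrime p.asIdeal))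
            - ewidth (Localization.AtPrime p.asIdeal)
              (ModuleCat.of (Localization.AtPrime p.asIdeal)
                (IsLocalRing.ResidueField (Localization.AtPrime p.asIdeal)))
              (ModuleCat.of (Localization.AtPrime p.asIdeal)
                (LocalizedModule p.asIdeal.primeCompl M))) := by
  simp_rw [subsingleton_extModule_iff] at hfin
  by_cases hM : Subsingleton M
  · have hext (N : ModuleCat.{0} R) (i : ℕ) :
        Subsingleton (Abelian.Ext.{0} N (ModuleCat.of R M) i) := by
      refine subsingleton_of_forall_eq 0 fun x => ?_
      have : 𝟙 (ModuleCat.of R M) = 0 :=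
        ModuleCat.hom_ext (LinearMap.ext fun x => Subsingleton.elim (α := M) _ _)
      rw [← Abelian.Ext.comp_mk₀_id x, this, Abelian.Ext.mk₀_zero, Abelian.Ext.comp_zero]
    have hleft : einjDim R (ModuleCat.of R M) = ⊥ := by
      refine sSup_eq_bot.2 ?_
      rintro x ⟨i, N, rfl, hi⟩
      exact (not_subsingleton_iff_nontrivial.2 ((nontrivial_extModule_iff i N _).1 hi)
        (hext N i)).elim
    rw [hleft]
    refine (iSup_eq_bot.2 fun p => ?_).symm
    have : Subsingleton (ModuleCat.of (Localization.AtPrime p.asIdeal)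
        (LocalizedModule p.asIdeal.primeCompl M)) :=
      inferInstanceAs (Subsingleton (LocalizedModule p.asIdeal.primeCompl M))
    rw [ewidth_eq_top_of_subsingleton, EReal.sub_top]
  · classical
    have hn := Nat.find_spec hfin
    set n := Nat.find hfin
    have hne : ∃ N : ModuleCat.{0} R,
        ¬ Subsingleton (Abelian.Ext.{0} N (ModuleCat.of R M) n) := by
      by_contra! hcon
      rcases Nat.eq_zero_or_pos n with h0 | hpos
      · rw [h0] at hcon
        refine hM (subsingleton_of_forall_eq 0 fun m => ?_)
        exact LinearMap.congr_fun (congrArg ModuleCat.Hom.hom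
          (subsingleton_ext_zero_iff.1 (hcon (ModuleCat.of R M)) (𝟙 _))) m
      · refine Nat.find_min hfin (m := n - 1) (by lia) fun N i hi => ?_
        rcases (show n ≤ i by lia).eq_or_lt with rfl | hlt
        · exact hcon N
        · exact hn N i hlt
    have hloc (p : Ideal R) [p.IsPrime] := subsingleton_ext_localizedModule_of_lt
      p.primeCompl (ModuleCat.of R M) n hn
    rw [einjDim_eq_of_isGreatest _ n hn hne]
    refine le_antisymm ?_ (iSup_le fun p => ?_)
    · obtain ⟨p, hp, hx⟩ := exists_prime_smul_ne_zero _ n hne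
      refine le_iSup_of_le ⟨p, hp⟩ ?_
      refine (le_edepth_sub_ewidth _ n (hloc p)
        (not_subsingleton_ext_localizedModule _ n hx)).trans_eq ?_
      exact congrArg _ (ewidth_congr _ (localizedModuleIso p.primeCompl (ModuleCat.of R M)))
    · refine le_trans (le_of_eq ?_) (edepth_sub_ewidth_le _ n (hloc p.asIdeal))
      exact congrArg _
        (ewidth_congr _ (localizedModuleIso p.asIdeal.primeCompl (ModuleCat.of R M))).symm
end
end

section
/- Let R be a commutative artinian ring and M an R-module. If there exists an integer n ≥ 0 such that Ext^n_R(k(p), M) = 0 for every prime ideal p of R, then the injective dimension of M is strictly less than n. -/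
open CategoryTheory Opposite

noncomputable section

theorem subsingleton_extModule_iff_s15 {R : Type} [CommRing R] {X : ModuleCat R}
    (P : ProjectiveResolution X) (Y : ModuleCat R) {p n m : ℕ}
    (hp : (ComplexShape.up ℕ).prev n = p) (hm : n + 1 = m) :
    Subsingleton (extModule R n X Y) ↔
      ∀ f : P.complex.X n ⟶ Y, P.complex.d m n ≫ f = 0 →
        ∃ g : P.complex.X p ⟶ Y, P.complex.d n p ≫ g = f := by
  rw [← ModuleCat.isZero_iff_subsingleton, extModule, (P.isoExt n Y).isZero_iff,
    ← HomologicalComplex.exactAt_iff_isZero_homology,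
    HomologicalComplex.exactAt_iff' _ p n m hp (by simp [hm]),
    ShortComplex.moduleCat_exact_iff]
  rfl

theorem subsingleton_ext_of_subsingleton_extModule {R : Type} [CommRing R] {X Y : ModuleCat R}
    {n : ℕ} (h : Subsingleton (extModule R n X Y)) : Subsingleton (Abelian.Ext X Y n) := by
  let P := ProjectiveResolution.of X
  cases n with
  | zero =>
    rw [subsingleton_extModule_iff_s15 P Y CochainComplex.prev_nat_zero rfl] at h
    refine Abelian.Ext.homEquiv₀.subsingleton_congr.mpr (subsingleton_of_forall_eq 0 fun f ↦ ?_)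
    let π : P.complex.X 0 ⟶ X := P.π.f 0
    have : Epi π := inferInstanceAs (Epi (P.π.f 0))
    have hπ : P.complex.d 1 0 ≫ π = 0 := P.complex_d_comp_π_f_zero
    obtain ⟨g, hg⟩ := h (π ≫ f) (by rw [← Category.assoc, hπ, Limits.zero_comp])
    rw [← cancel_epi π, Limits.comp_zero, ← hg, P.complex.shape 0 0 (by simp), Limits.zero_comp]
  | succ n =>
    rw [subsingleton_extModule_iff_s15 P Y (CochainComplex.prev_nat_succ n) rfl] at h
    refine subsingleton_of_forall_eq 0 fun α ↦ ?_
    obtain ⟨f, hf, rfl⟩ := P.extMk_surjective α _ rfl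
    exact (P.extMk_eq_zero_iff f _ rfl hf n rfl).mpr (h f hf)

theorem subsingleton_extModule_of_hasInjectiveDimensionLT {R : Type} [CommRing R]
    (X Y : ModuleCat R) (n : ℕ) [HasInjectiveDimensionLT Y n] :
    Subsingleton (extModule R n X Y) := by
  let P := ProjectiveResolution.of X
  cases n with
  | zero =>
    rw [subsingleton_extModule_iff_s15 P Y CochainComplex.prev_nat_zero rfl]
    exact fun f _ ↦ ⟨0, (isZero_of_hasInjectiveDimensionLT_zero Y).eq_of_tgt _ _⟩
  | succ n =>
    rw [subsingleton_extModule_iff_s15 P Y (CochainComplex.prev_nat_succ n) rfl]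
    intro f hf
    rw [← P.extMk_eq_zero_iff f _ rfl hf n rfl]
    exact Abelian.Ext.eq_zero_of_hasInjectiveDimensionLT _ (n + 1) le_rfl

theorem subsingleton_ext_of_finite {R : Type} [CommRing R] [IsNoetherianRing R] {M : ModuleCat R}
    {n : ℕ} (h : ∀ p : PrimeSpectrum R, Subsingleton (Abelian.Ext (ModuleCat.of R (R ⧸ p.1)) M n))
    (N : Type) [AddCommGroup N] [Module R N] [Module.Finite R N] :
    Subsingleton (Abelian.Ext (ModuleCat.of R N) M n) := by
  induction ‹Module.Finite R N› using
    IsNoetherianRing.induction_on_isQuotientEquivQuotientPrime R with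
  | subsingleton N =>
    refine subsingleton_of_forall_eq 0 fun α ↦ ?_
    rw [← Abelian.Ext.mk₀_id_comp α, (ModuleCat.isZero_of_subsingleton _).eq_of_src (𝟙 _) 0]
    simp
  | quotient N p e =>
    have := h p
    refine subsingleton_of_forall_eq 0 fun α ↦ ?_
    have := (Abelian.Ext.mk₀_id_comp α).symm
    rw [← e.toModuleIso.hom_inv_id, ← Abelian.Ext.mk₀_comp_mk₀,
      Abelian.Ext.comp_assoc _ _ _ _ (zero_add n) (by lia)] at this
    rw [this, Subsingleton.elim ((Abelian.Ext.mk₀ e.toModuleIso.inv).comp α (zero_add n)) 0,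
      Abelian.Ext.comp_zero]
  | exact N₁ N₂ N₃ f g hf hg hfg h₁ h₃ =>
    refine subsingleton_of_forall_eq 0 fun α ↦ ?_
    let S : ShortComplex (ModuleCat R) :=
      ModuleCat.shortComplexOfCompEqZero f g hfg.linearMap_comp_eq_zero
    have hS : S.ShortExact := ModuleCat.shortComplex_shortExact S hfg hf hg
    obtain ⟨β, rfl⟩ := Abelian.Ext.contravariant_sequence_exact₂ hS M α (Subsingleton.elim _ _)
    rw [Subsingleton.elim β 0, Abelian.Ext.comp_zero]

theorem injective_of_subsingleton_ext_one {R : Type} [CommRing R] {M : ModuleCat R}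
    (h : ∀ I : Ideal R, Subsingleton (Abelian.Ext (ModuleCat.of R (R ⧸ I)) M 1)) :
    Injective M := by
  rw [← Module.injective_iff_injective_object, ← Module.Baer.iff_injective]
  intro I g
  let S : ShortComplex (ModuleCat R) :=
    ModuleCat.shortComplexOfCompEqZero I.subtype I.mkQ
      (LinearMap.exact_subtype_mkQ I).linearMap_comp_eq_zero
  have hS : S.ShortExact := ModuleCat.shortComplex_shortExact S
    (LinearMap.exact_subtype_mkQ I) I.injective_subtype I.mkQ_surjective
  have := h I
  obtain ⟨β, hβ⟩ := Abelian.Ext.contravariant_sequence_exact₁ hS M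
    (Abelian.Ext.mk₀ (ModuleCat.ofHom g)) (add_zero 1) (Subsingleton.elim _ _)
  obtain ⟨k, rfl⟩ := Abelian.Ext.homEquiv₀.symm.surjective β
  refine ⟨k.hom, fun x hx ↦ ?_⟩
  rw [Abelian.Ext.homEquiv₀_symm_apply, Abelian.Ext.mk₀_comp_mk₀] at hβ
  exact LinearMap.congr_fun (congrArg ModuleCat.Hom.hom
    (Abelian.Ext.homEquiv₀.symm.injective hβ)) ⟨x, hx⟩

theorem hasInjectiveDimensionLT_of_subsingleton_ext_quotient {R : Type} [CommRing R]
    {M : ModuleCat R} {n : ℕ}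
    (h : ∀ I : Ideal R, Subsingleton (Abelian.Ext (ModuleCat.of R (R ⧸ I)) M n)) :
    HasInjectiveDimensionLT M n := by
  induction n generalizing M with
  | zero =>
    rw [hasInjectiveDimensionLT_zero_iff_isZero, ModuleCat.isZero_iff_subsingleton]
    refine subsingleton_of_forall_eq 0 fun x ↦ ?_
    have := (Abelian.Ext.homEquiv₀.subsingleton_congr).mp (h ⊥)
    have := LinearMap.congr_fun (congrArg ModuleCat.Hom.hom (Subsingleton.elim (ModuleCat.ofHom
      (Submodule.liftQ ⊥ (LinearMap.toSpanSingleton R M x) bot_le)) 0))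
      (Submodule.Quotient.mk (1 : R))
    rw [← one_smul R x]
    exact this
  | succ n ih =>
    cases n with
    | zero =>
      rw [← injective_iff_hasInjectiveDimensionLT_one]
      exact injective_of_subsingleton_ext_one h
    | succ n =>
      obtain ⟨I, _, f, _⟩ := EnoughInjectives.presentation M
      have hS : (ShortComplex.mk f _ (Limits.cokernel.condition f)).ShortExact :=
        { exact := ShortComplex.exact_cokernel f }
      rw [← hS.hasInjectiveDimensionLT_X₃_iff n inferInstance]
      refine ih fun J ↦ subsingleton_of_forall_eq 0 fun α ↦ ?_
      have := h J
      obtain ⟨β, rfl⟩ := Abelian.Ext.covariant_sequence_exact₃ _ hS α rfl (Subsingleton.elim _ _)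
      simp [Abelian.Ext.eq_zero_of_injective β]

/-- `R` artinian. If `Ext^n_R(k(p), M) = 0` for every prime `p`, then the
injective dimension of `M` is `< n`, i.e. `Ext^i_R(N, M) = 0` for all `N` and all `i ≥ n`. -/
theorem injDim_lt_of_ext_vanishing_artinian
    (R : Type) [CommRing R] [IsArtinianRing R]
    (M : Type) [AddCommGroup M] [Module R M] (n : ℕ)
    (hvan : ∀ (p : Ideal R) (hp : p.IsPrime),
      Subsingleton (extModule R n (ModuleCat.of R (resField R p)) (ModuleCat.of R M))) :
    ∀ (N : ModuleCat R) (i : ℕ), n ≤ i →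
      Subsingleton (extModule R i N (ModuleCat.of R M)) := by
  have : HasInjectiveDimensionLT (ModuleCat.of R M) n := by
    refine hasInjectiveDimensionLT_of_subsingleton_ext_quotient fun I ↦
      subsingleton_ext_of_finite (fun p ↦ ?_) _
    have : p.1.IsMaximal := IsArtinianRing.isMaximal_of_isPrime p.1
    let e : (R ⧸ p.1) ≃ₗ[R] resField R p.1 := LinearEquiv.ofBijective
      (IsScalarTower.toAlgHom R (R ⧸ p.1) p.1.ResidueField).toLinearMap
      p.1.bijective_algebraMap_quotient_residueField
    apply subsingleton_ext_of_subsingleton_extModule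
    have := hvan p.1 p.2
    exact (((Ext R (ModuleCat R) n).mapIso e.toModuleIso.op).app
      (ModuleCat.of R M)).symm.toLinearEquiv.toEquiv.subsingleton_congr.mpr this
  intro N i hi
  have := hasInjectiveDimensionLT_of_ge (ModuleCat.of R M) n i hi
  exact subsingleton_extModule_of_hasInjectiveDimensionLT N _ i
end
end

section
/- Let (R, m, k) be a commutative noetherian local ring and E the injective envelope of k. Then for every prime ideal p of R, the localization (E^ℕ)_p of the countable product E^ℕ = ∏_{n∈ℕ} E at p is nonzero. -/
noncomputable section

open IsLocalRing

/-- An injective module containing the residue field of a local ring is a cogenerator. -/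
lemma IsLocalRing.exists_linearMap_apply_ne_zero
    {R : Type} [CommRing R] [IsLocalRing R]
    {E : Type} [AddCommGroup E] [Module R E] [Module.Injective R E]
    (f : ResidueField R →ₗ[R] E) (hf : Function.Injective f)
    {M : Type} [AddCommGroup M] [Module R M] {x : M} (hx : x ≠ 0) :
    ∃ g : M →ₗ[R] E, g x ≠ 0 := by
  let a := LinearMap.toSpanSingleton R M x
  let b : R →ₗ[R] E := f ∘ₗ Algebra.linearMap R (ResidueField R)
  have hab : LinearMap.ker a ≤ LinearMap.ker b := by
    intro r hr
    have hr' : r • x = 0 := hr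
    have hrm : r ∈ maximalIdeal R := by
      by_contra h
      exact hx (((notMem_maximalIdeal.mp h).smul_eq_zero).mp hr')
    exact (congrArg f ((residue_eq_zero_iff r).mpr hrm)).trans (map_zero f)
  obtain ⟨g, hg⟩ := Module.Injective.out ((LinearMap.ker a).liftQ a le_rfl)
    (LinearMap.ker_eq_bot.mp (Submodule.ker_liftQ_eq_bot _ _ _ le_rfl))
    ((LinearMap.ker a).liftQ b hab)
  refine ⟨g, fun h => ?_⟩
  have h1 := hg (Submodule.Quotient.mk 1)
  rw [Submodule.liftQ_apply, Submodule.liftQ_apply] at h1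
  have h2 : f 1 = 0 := by simpa [a, b, h] using h1.symm
  exact one_ne_zero (hf (h2.trans (map_zero f).symm))

/-- Some finite set of elements of `E` has its common annihilator inside `I` when `R ⧸ I` is
artinian. -/
lemma IsLocalRing.exists_finite_forall_smul_eq_zero_imp_mem
    {R : Type} [CommRing R] [IsLocalRing R]
    {E : Type} [AddCommGroup E] [Module R E] [Module.Injective R E]
    (f : ResidueField R →ₗ[R] E) (hf : Function.Injective f)
    (I : Ideal R) [IsArtinian R (R ⧸ I)] :
    ∃ S : Set E, S.Finite ∧ ∀ r : R, (∀ e ∈ S, r • e = 0) → r ∈ I := by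
  classical
  obtain ⟨t, ht⟩ := Finset.exists_inf_le (fun g : (R ⧸ I) →ₗ[R] E => LinearMap.ker g)
  refine ⟨(fun g => g (Submodule.Quotient.mk 1)) '' (t : Set ((R ⧸ I) →ₗ[R] E)),
    t.finite_toSet.image _, fun r hr => ?_⟩
  by_contra hrI
  have hr0 : (Submodule.Quotient.mk r : R ⧸ I) ≠ 0 := by
    rwa [Ne, Submodule.Quotient.mk_eq_zero]
  obtain ⟨g, hg⟩ := exists_linearMap_apply_ne_zero f hf hr0
  refine hg (ht g ?_)
  rw [Submodule.mem_finsetInf]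
  intro g' hg'
  have h := hr _ ⟨g', hg', rfl⟩
  rw [← map_smul, ← Submodule.Quotient.mk_smul, smul_eq_mul, mul_one] at h
  exact h

/-- The quotients of a noetherian local ring by powers of its maximal ideal are artinian. -/
lemma IsLocalRing.isArtinian_quotient_maximalIdeal_pow
    (R : Type) [CommRing R] [IsNoetherianRing R] [IsLocalRing R] (n : ℕ) :
    IsArtinian R (R ⧸ maximalIdeal R ^ n) := by
  rcases eq_or_ne n 0 with rfl | hn
  · have : Subsingleton (R ⧸ maximalIdeal R ^ 0) := by
      rw [Ideal.Quotient.subsingleton_iff, pow_zero, Ideal.one_eq_top]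
    exact isArtinian_of_finite
  have hne : maximalIdeal R ^ n ≠ ⊤ :=
    ne_top_of_le_ne_top Ideal.IsPrime.ne_top' (Ideal.pow_le_self hn)
  have : Nontrivial (R ⧸ maximalIdeal R ^ n) := Ideal.Quotient.nontrivial_iff.mpr hne
  let q := Ideal.Quotient.mk (maximalIdeal R ^ n)
  have hq : Function.Surjective q := Ideal.Quotient.mk_surjective
  have := IsLocalRing.of_surjective' q hq
  have : IsArtinianRing (R ⧸ maximalIdeal R ^ n) := by
    rw [isArtinianRing_iff_isNilpotent_maximalIdeal, ← map_maximalIdeal_of_surjective q hq]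
    exact ⟨n, by rw [← Ideal.map_pow, Ideal.map_quotient_self, Ideal.zero_eq_bot]⟩
  exact isArtinian_of_surjective_algebraMap (R := R ⧸ maximalIdeal R ^ n) hq

/-- A countable product of copies of `E` has an element with zero annihilator. -/
lemma IsLocalRing.exists_nat_seq_smul_eq_zero_imp
    {R : Type} [CommRing R] [IsNoetherianRing R] [IsLocalRing R]
    {E : Type} [AddCommGroup E] [Module R E] [Module.Injective R E]
    (f : ResidueField R →ₗ[R] E) (hf : Function.Injective f) :
    ∃ x : ℕ → E, ∀ r : R, r • x = 0 → r = 0 := by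
  have := isArtinian_quotient_maximalIdeal_pow R
  choose S hfin hS using fun n : ℕ =>
    exists_finite_forall_smul_eq_zero_imp_mem f hf (maximalIdeal R ^ n)
  have hcount : (insert 0 (⋃ n, S n)).Countable :=
    (Set.countable_iUnion fun n => (hfin n).countable).insert 0
  obtain ⟨x, hx⟩ := hcount.exists_eq_range (Set.insert_nonempty _ _)
  refine ⟨x, fun r hr => ?_⟩
  rw [← Ideal.mem_bot, ← Ideal.iInf_pow_eq_bot_of_isLocalRing (maximalIdeal R) Ideal.IsPrime.ne_top',
    Ideal.mem_iInf]
  refine fun n => hS n r fun e he => ?_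
  obtain ⟨i, rfl⟩ : e ∈ Set.range x := hx ▸ Set.mem_insert_of_mem 0 (Set.mem_iUnion_of_mem n he)
  exact congrFun hr i

/-- `(R, m, k)` local noetherian, `E` the injective envelope of `k`
(an injective module containing `k` as an essential submodule). Then for every prime `p`,
the localization `(E^ℕ)_p` of the countable product `E^ℕ` at `p` is nonzero. -/
theorem localization_of_product_of_injectiveHull_nontrivial
    (R : Type) [CommRing R] [IsNoetherianRing R] [IsLocalRing R]
    (E : Type) [AddCommGroup E] [Module R E]
    (hEinj : Module.Injective R E)
    (f : IsLocalRing.ResidueField R →ₗ[R] E)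
    (hf : Function.Injective f)
    (hess : ∀ N : Submodule R E, N ≠ ⊥ → N ⊓ LinearMap.range f ≠ ⊥)
    (p : Ideal R) [p.IsPrime] :
    Nontrivial (LocalizedModule p.primeCompl (ℕ → E)) := by
  obtain ⟨x, hx⟩ := exists_nat_seq_smul_eq_zero_imp f hf
  rw [← not_subsingleton_iff_nontrivial, LocalizedModule.subsingleton_iff]
  intro h
  obtain ⟨r, hr, hrx⟩ := h x
  exact hr (hx r hrx ▸ p.zero_mem)
end
end
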